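/- arXiv:2204.10490 — 2 statements merged into one kernel-verified Lean document; each statement's English description precedes it below -/
import Mathlib

section
/- Open KKM theorem: Let A1, ..., An be open subsets of the standard simplex Δ^{n-1} ⊆ ℝⁿ such that every face σ = conv{e_i : i ∈ I} of Δ^{n-1} is covered by the union of the A_i with i ∈ I. Then the intersection A1 ∩ ... ∩ An is nonempty. -/
open Set

namespace KKM

open Classical in
/-- Coboundary mod 2 on functions of multisets. -/
noncomputable def dd {E : Type*} (f : Multiset E → ZMod 2) (s : Multiset E) : ZMod 2 :=
  (s.map (fun x => f (s.erase x))).sum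

section alg
variable {E : Type*}

lemma dd_zero (f : Multiset E → ZMod 2) : dd f 0 = 0 := by simp [dd]

lemma dd_cons (f : Multiset E → ZMod 2) (a : E) (s : Multiset E) :
    dd f (a ::ₘ s) = f s + dd (fun t => f (a ::ₘ t)) s := by
  classical
  unfold dd
  rw [Multiset.map_cons, Multiset.sum_cons]
  congr 1
  · congr 1
    exact Multiset.erase_cons_head a s
  · congr 1
    apply Multiset.map_congr rfl
    intro x hx
    congr 1
    by_cases h : a = x
    · subst h
      rw [Multiset.erase_cons_head, Multiset.cons_erase hx]
    · rw [Multiset.erase_cons_tail _ h]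

lemma dd_add (f g : Multiset E → ZMod 2) : dd (f + g) = dd f + dd g := by
  funext s
  simp [dd, Multiset.sum_map_add]

lemma dd_dd (s : Multiset E) : ∀ f : Multiset E → ZMod 2, dd (dd f) s = 0 := by
  induction s using Multiset.induction_on with
  | empty => intro f; exact dd_zero _
  | cons a s ih =>
    intro f
    rw [dd_cons]
    have : (fun t => dd f (a ::ₘ t)) = f + dd (fun t => f (a ::ₘ t)) := by
      funext t; rw [dd_cons]; rfl
    rw [this, dd_add, Pi.add_apply, ih, add_zero]
    exact CharTwo.add_self_eq_zero _

lemma dd_congr (f g : Multiset E → ZMod 2) (s : Multiset E)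
    (h : ∀ t, t.card + 1 = s.card → f t = g t) : dd f s = dd g s := by
  classical
  unfold dd
  congr 1
  apply Multiset.map_congr rfl
  intro x hx
  apply h
  have := Multiset.card_erase_add_one hx
  convert this

lemma dd_ne_zero (f : Multiset E → ZMod 2) (s : Multiset E) (h : dd f s ≠ 0) :
    ∃ x t, s = x ::ₘ t ∧ f t ≠ 0 := by
  classical
  by_contra! hc
  apply h
  unfold dd
  apply Multiset.sum_eq_zero
  intro y hy
  obtain ⟨x, hx, rfl⟩ := Multiset.mem_map.1 hy
  apply hc x
  have := (Multiset.cons_erase hx).symm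
  convert this

/-- Fuelled (dual) barycentric subdivision. -/
noncomputable def SS (b : Multiset E → E) : ℕ → (Multiset E → ZMod 2) → Multiset E → ZMod 2
  | 0, f, s => f s
  | m + 1, f, s => dd (fun t => SS b m (fun u => f (b s ::ₘ u)) t) s

lemma SS_add (b : Multiset E → E) (m : ℕ) : ∀ (f g : Multiset E → ZMod 2),
    SS b m (f + g) = SS b m f + SS b m g := by
  induction m with
  | zero => intro f g; rfl
  | succ m ih =>
    intro f g
    funext s
    simp only [SS, Pi.add_apply]
    have := ih (fun u => f (b s ::ₘ u)) (fun u => g (b s ::ₘ u))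
    have h2 := congrFun (dd_add (SS b m (fun u => f (b s ::ₘ u))) (SS b m (fun u => g (b s ::ₘ u)))) s
    rw [← this] at h2
    exact h2

noncomputable def Sd (b : Multiset E → E) (f : Multiset E → ZMod 2) (s : Multiset E) : ZMod 2 :=
  SS b s.card f s

lemma Sd_add (b : Multiset E → E) (f g : Multiset E → ZMod 2) :
    Sd b (f + g) = Sd b f + Sd b g := by
  funext s
  simp [Sd, SS_add]

lemma SS_dd (b : Multiset E → E) (m : ℕ) : ∀ (f : Multiset E → ZMod 2) (s : Multiset E),
    s.card = m → SS b m (dd f) s = dd (Sd b f) s := by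
  induction m with
  | zero =>
    intro f s hs
    rw [Multiset.card_eq_zero] at hs
    subst hs
    simp [SS, dd_zero]
  | succ m ih =>
    intro f s hs
    have e : (fun u => dd f (b s ::ₘ u)) = f + dd (fun u => f (b s ::ₘ u)) := by
      funext u; rw [dd_cons]; rfl
    change dd (SS b m (fun u => dd f (b s ::ₘ u))) s = _
    rw [e, SS_add, dd_add, Pi.add_apply]
    have h2 : dd (SS b m (dd fun u => f (b s ::ₘ u))) s = 0 := by
      rw [← dd_dd s (Sd b (fun u => f (b s ::ₘ u)))]
      apply dd_congr
      intro t ht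
      exact ih _ _ (by omega)
    rw [h2, add_zero]
    apply dd_congr
    intro t ht
    have : t.card = m := by omega
    simp [Sd, this]

lemma Sd_dd (b : Multiset E → E) (f : Multiset E → ZMod 2) : Sd b (dd f) = dd (Sd b f) := by
  funext s
  exact SS_dd b _ f s rfl

lemma Sd_iter_dd (b : Multiset E → E) (k : ℕ) (f : Multiset E → ZMod 2) :
    (Sd b)^[k] (dd f) = dd ((Sd b)^[k] f) := by
  induction k with
  | zero => rfl
  | succ k ih => rw [Function.iterate_succ_apply', ih, Sd_dd, Function.iterate_succ_apply']

lemma Sd_iter_add (b : Multiset E → E) (k : ℕ) (f g : Multiset E → ZMod 2) :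
    (Sd b)^[k] (f + g) = (Sd b)^[k] f + (Sd b)^[k] g := by
  induction k with
  | zero => rfl
  | succ k ih => simp only [Function.iterate_succ_apply', ih, Sd_add]

end alg

section geom
variable {E : Type*} [NormedAddCommGroup E] [NormedSpace ℝ E]

noncomputable def bary (s : Multiset E) : E := (s.card : ℝ)⁻¹ • s.sum

lemma bary_mem (C : Set E) (hC : Convex ℝ C) (s : Multiset E) :
    s ≠ 0 → (∀ x ∈ s, x ∈ C) → bary s ∈ C := by
  induction s using Multiset.induction_on with
  | empty => intro h; exact absurd rfl h
  | cons a s ih =>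
    intro _ h
    by_cases hs : s = 0
    · subst hs
      simpa [bary] using h a (by simp)
    · have h1 := ih hs (fun x hx => h x (Multiset.mem_cons_of_mem hx))
      have h2 := h a (Multiset.mem_cons_self a s)
      have hm : (0 : ℝ) < s.card := by
        exact_mod_cast Multiset.card_pos.2 hs
      have h3 := hC h2 h1 (a := 1 / ((s.card : ℝ) + 1)) (b := s.card / ((s.card : ℝ) + 1))
        (by positivity) (by positivity) (by field_simp; ring)
      convert h3 using 1
      simp only [bary, Multiset.card_cons, Multiset.sum_cons, smul_add, smul_smul]
      push_cast
      congr 2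
      · simp
      · field_simp

lemma sum_bound (x : E) (D : ℝ) (s : Multiset E) :
    (∀ y ∈ s, dist y x ≤ D) → ‖s.sum - (s.card : ℝ) • x‖ ≤ s.card * D := by
  induction s using Multiset.induction_on with
  | empty => intro _; simp
  | cons a s ih =>
    intro h
    have h1 := ih (fun y hy => h y (Multiset.mem_cons_of_mem hy))
    have h2 := h a (Multiset.mem_cons_self a s)
    rw [dist_eq_norm] at h2
    have e : (a ::ₘ s).sum - (((a ::ₘ s).card : ℕ) : ℝ) • x
        = (a - x) + (s.sum - (s.card : ℝ) • x) := by
      simp only [Multiset.card_cons, Multiset.sum_cons]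
      push_cast
      module
    rw [e]
    refine (norm_add_le _ _).trans ?_
    simp only [Multiset.card_cons]
    push_cast
    linarith

lemma bary_dist (N : ℕ) (D : ℝ) (s : Multiset E) (hN : s.card ≤ N)
    (h : ∀ x ∈ s, ∀ y ∈ s, dist x y ≤ D) (x : E) (hx : x ∈ s) :
    dist x (bary s) ≤ (1 - 1 / (N : ℝ)) * D := by
  have hD : 0 ≤ D := by simpa using h x hx x hx
  obtain ⟨t, rfl⟩ := Multiset.exists_cons_of_mem hx
  have h1 := sum_bound x D t (fun y hy => h y (Multiset.mem_cons_of_mem hy) x hx)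
  rw [Multiset.card_cons] at hN
  have hN' : (t.card : ℝ) + 1 ≤ N := by exact_mod_cast hN
  have hp : (0 : ℝ) < (t.card : ℝ) + 1 := by positivity
  have e : bary (x ::ₘ t) - x = ((t.card : ℝ) + 1)⁻¹ • (t.sum - (t.card : ℝ) • x) := by
    have : x = ((t.card : ℝ) + 1)⁻¹ • (((t.card : ℝ) + 1) • x) := by
      rw [smul_smul, inv_mul_cancel₀ hp.ne', one_smul]
    conv_lhs => rw [this]
    rw [← this]
    simp only [bary, Multiset.card_cons, Multiset.sum_cons]
    push_cast
    conv_lhs => rhs; rw [this]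
    rw [← smul_sub]
    congr 1
    module
  rw [dist_comm, dist_eq_norm, e, norm_smul, Real.norm_of_nonneg (by positivity)]
  calc _ ≤ ((t.card : ℝ) + 1)⁻¹ * (t.card * D) := by gcongr
    _ = (1 - 1 / ((t.card : ℝ) + 1)) * D := by field_simp; ring
    _ ≤ _ := by gcongr

/-- Support lemma. -/
lemma SS_support (N : ℕ) (C : Set E) (hC : Convex ℝ C) (D : ℝ) (m : ℕ) :
    ∀ (f : Multiset E → ZMod 2) (s : Multiset E), s.card = m → m ≤ N → (∀ x ∈ s, x ∈ C) →
      (∀ x ∈ s, ∀ y ∈ s, dist x y ≤ D) → SS bary m f s ≠ 0 →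
      ∃ t, f t ≠ 0 ∧ t.card = m ∧ (∀ x ∈ t, x ∈ C) ∧
        (∀ x ∈ t, x ∈ convexHull ℝ {y | y ∈ s}) ∧
        (∀ x ∈ t, ∀ y ∈ t, dist x y ≤ (1 - 1 / (N : ℝ)) * D) := by
  induction m with
  | zero =>
    intro f s hs hm hsC hsD h
    rw [Multiset.card_eq_zero] at hs
    subst hs
    exact ⟨0, h, by simp, by simp, by simp, by simp⟩
  | succ m ih =>
    intro f s hs hm hsC hsD h
    obtain ⟨x, t, rfl, ht⟩ := dd_ne_zero _ _ h
    have hne : (x ::ₘ t) ≠ 0 := Multiset.cons_ne_zero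
    obtain ⟨u, hu, huc, huC, huH, huD⟩ := ih _ t (by simpa using hs) (by omega)
      (fun y hy => hsC y (Multiset.mem_cons_of_mem hy))
      (fun y hy z hz => hsD y (Multiset.mem_cons_of_mem hy) z (Multiset.mem_cons_of_mem hz)) ht
    have hsub : convexHull ℝ {y | y ∈ t} ⊆ convexHull ℝ {y | y ∈ x ::ₘ t} :=
      convexHull_mono (fun y hy => Multiset.mem_cons_of_mem hy)
    have hball : ∀ y ∈ u, dist y (bary (x ::ₘ t)) ≤ (1 - 1 / (N : ℝ)) * D := by
      intro y hy
      have : convexHull ℝ {y | y ∈ x ::ₘ t} ⊆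
          Metric.closedBall (bary (x ::ₘ t)) ((1 - 1 / (N : ℝ)) * D) :=
        convexHull_min (fun z hz => bary_dist N D _ (by omega) hsD z hz) (convex_closedBall _ _)
      exact this (hsub (huH y hy))
    have hD : 0 ≤ D := by simpa using hsD x (by simp) x (by simp)
    have hN1 : (1 : ℝ) ≤ N := by exact_mod_cast (by omega : 1 ≤ N)
    have hr : 0 ≤ (1 - 1 / (N : ℝ)) * D := by
      apply mul_nonneg _ hD
      rw [sub_nonneg, div_le_one (by linarith)]
      exact hN1
    refine ⟨bary (x ::ₘ t) ::ₘ u, hu, by simp [huc], ?_, ?_, ?_⟩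
    · intro y hy
      rcases Multiset.mem_cons.1 hy with rfl | hy
      · exact bary_mem C hC _ hne hsC
      · exact huC y hy
    · intro y hy
      rcases Multiset.mem_cons.1 hy with rfl | hy
      · exact bary_mem _ (convex_convexHull ℝ _) _ hne (fun z hz => subset_convexHull ℝ _ hz)
      · exact hsub (huH y hy)
    · intro y hy z hz
      rcases Multiset.mem_cons.1 hy with rfl | hy <;> rcases Multiset.mem_cons.1 hz with rfl | hz
      · simpa using hr
      · rw [dist_comm]; exact hball z hz
      · exact hball y hy
      · exact huD y hy z hz

lemma Sd_iter_support (N : ℕ) (C : Set E) (hC : Convex ℝ C) (k : ℕ) :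
    ∀ (D : ℝ) (f : Multiset E → ZMod 2) (s : Multiset E), s.card ≤ N → (∀ x ∈ s, x ∈ C) →
      (∀ x ∈ s, ∀ y ∈ s, dist x y ≤ D) → (Sd bary)^[k] f s ≠ 0 →
      ∃ t, f t ≠ 0 ∧ t.card = s.card ∧ (∀ x ∈ t, x ∈ C) ∧
        (∀ x ∈ t, ∀ y ∈ t, dist x y ≤ (1 - 1 / (N : ℝ)) ^ k * D) := by
  induction k with
  | zero =>
    intro D f s hs hsC hsD h
    exact ⟨s, h, rfl, hsC, by simpa using hsD⟩
  | succ k ih =>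
    intro D f s hs hsC hsD h
    rw [Function.iterate_succ_apply'] at h
    obtain ⟨t, ht, htc, htC, -, htD⟩ := SS_support N C hC D _ _ s rfl hs hsC hsD h
    obtain ⟨u, hu, huc, huC, huD⟩ := ih _ f t (by omega) htC htD ht
    refine ⟨u, hu, by omega, huC, ?_⟩
    intro x hx y hy
    rw [pow_succ, mul_assoc]
    exact huD x hx y hy

end geom

open Classical in
/-- Indicator of multisets labelled exactly by `J`. -/
noncomputable def ind {E ι : Type*} (lam : E → ι) (J : Finset ι) (s : Multiset E) : ZMod 2 :=
  if s.map lam = J.val then 1 else 0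

lemma dd_ind {E ι : Type*} [DecidableEq ι] (lam : E → ι) (J : Finset ι) (i : ι) (hi : i ∉ J)
    (s : Multiset E) (hs : ∀ x ∈ s, lam x ∈ insert i J) :
    dd (ind lam J) s = ind lam (insert i J) s := by
  classical
  have key : dd (ind lam J) s
      = ((s.map lam).map (fun j => if s.map lam = j ::ₘ J.val then (1 : ZMod 2) else 0)).sum := by
    unfold dd ind
    rw [Multiset.map_map]
    congr 1
    apply Multiset.map_congr rfl
    intro x hx
    obtain ⟨t, rfl⟩ := Multiset.exists_cons_of_mem hx
    simp
  rw [key]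
  unfold ind
  rw [Finset.insert_val_of_notMem hi]
  by_cases h : ∃ j, s.map lam = j ::ₘ J.val
  · obtain ⟨j, hj⟩ := h
    have hjm : j ∈ insert i J := by
      have : j ∈ s.map lam := by rw [hj]; simp
      obtain ⟨x, hx, rfl⟩ := Multiset.mem_map.1 this
      exact hs x hx
    rw [hj]
    simp only [Multiset.cons_inj_left]
    have : ∀ w : Multiset ι, (w.map (fun a => if j = a then (1 : ZMod 2) else 0)).sum
        = (w.count j : ZMod 2) := by
      intro w
      induction w using Multiset.induction_on with
      | empty => simp
      | cons a w ih =>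
        rw [Multiset.map_cons, Multiset.sum_cons, ih, Multiset.count_cons]
        push_cast
        ring
    rw [this, Multiset.count_cons_self]
    rcases Finset.mem_insert.1 hjm with rfl | hjJ
    · rw [Multiset.count_eq_zero_of_notMem (by simpa using hi)]
      simp
    · rw [Multiset.count_eq_one_of_mem J.nodup hjJ]
      have : j ≠ i := fun h => hi (h ▸ hjJ)
      simp only [this, if_false]
      decide
  · push Not at h
    simp [h]

/-- Face of the simplex. -/
def face {n : ℕ} (I : Finset (Fin n)) : Set (Fin n → ℝ) :=
  {x | x ∈ stdSimplex ℝ (Fin n) ∧ ∀ i ∉ I, x i = 0}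

lemma face_convex {n : ℕ} (I : Finset (Fin n)) : Convex ℝ (face I) := by
  intro x hx y hy a b ha hb hab
  refine ⟨convex_stdSimplex ℝ _ hx.1 hy.1 ha hb hab, ?_⟩
  intro i hi
  simp [hx.2 i hi, hy.2 i hi]

lemma single_mem_face {n : ℕ} (I : Finset (Fin n)) (i : Fin n) (hi : i ∈ I) :
    (Pi.single i 1 : Fin n → ℝ) ∈ face I := by
  refine ⟨single_mem_stdSimplex ℝ i, ?_⟩
  intro j hj
  rw [Pi.single_apply, if_neg]
  rintro rfl
  exact hj hi

lemma face_compact {n : ℕ} (I : Finset (Fin n)) : IsCompact (face I) := by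
  have : face I = stdSimplex ℝ (Fin n) ∩ {x | ∀ i ∉ I, x i = 0} := rfl
  rw [this]
  apply (isCompact_stdSimplex ℝ (Fin n)).inter_right
  simp only [Set.ofPred_forall]
  refine isClosed_iInter fun i => isClosed_iInter fun _ => ?_
  exact isClosed_eq (continuous_apply i) continuous_const

lemma face_subset {n : ℕ} (I : Finset (Fin n)) :
    face I ⊆ convexHull ℝ {x | ∃ i ∈ I, x = Pi.single i 1} := by
  intro x hx
  have hsum : ∑ i ∈ I, x i = 1 := by
    rw [← hx.1.2]
    exact Finset.sum_subset (Finset.subset_univ I) (fun i _ hi => hx.2 i hi)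
  have h := (convex_convexHull ℝ {x : Fin n → ℝ | ∃ i ∈ I, x = Pi.single i 1}).sum_mem
    (t := I) (w := x) (z := fun i => Pi.single i 1) (fun i _ => hx.1.1 i) hsum
    (fun i hi => subset_convexHull ℝ _ ⟨i, hi, rfl⟩)
  convert h using 1
  funext j
  rw [Finset.sum_apply]
  simp only [Pi.smul_apply, Pi.single_apply, smul_eq_mul, mul_ite, mul_one, mul_zero,
    Finset.sum_ite_eq]
  split_ifs with hj
  · rfl
  · exact hx.2 j hj

lemma simplex_dist {n : ℕ} {x y : Fin n → ℝ} (hx : x ∈ stdSimplex ℝ (Fin n))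
    (hy : y ∈ stdSimplex ℝ (Fin n)) : dist x y ≤ 1 := by
  rw [dist_pi_le_iff zero_le_one]
  intro i
  have h1 : ∀ z ∈ stdSimplex ℝ (Fin n), 0 ≤ z i ∧ z i ≤ 1 := by
    intro z hz
    refine ⟨hz.1 i, ?_⟩
    rw [← hz.2]
    exact Finset.single_le_sum (fun j _ => hz.1 j) (Finset.mem_univ i)
  rw [Real.dist_eq, abs_le]
  constructor <;> linarith [h1 x hx, h1 y hy]

lemma sperner {n : ℕ} (lam : (Fin n → ℝ) → Fin n)
    (hlam : ∀ I, ∀ x ∈ face I, lam x ∈ I) (k : ℕ) (I : Finset (Fin n)) :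
    (Sd bary)^[k] (ind lam I) (I.val.map (fun i => (Pi.single i 1 : Fin n → ℝ))) = 1 := by
  classical
  have loc : ∀ (I : Finset (Fin n)) (f g : Multiset (Fin n → ℝ) → ZMod 2),
      (∀ t : Multiset (Fin n → ℝ), (∀ x ∈ t, x ∈ face I) → f t = g t) →
      (Sd bary)^[k] f (I.val.map (fun i => (Pi.single i 1 : Fin n → ℝ)))
      = (Sd bary)^[k] g (I.val.map (fun i => (Pi.single i 1 : Fin n → ℝ))) := by
    intro I f g hfg
    by_contra hne
    have h1 : (Sd bary)^[k] (f + g) (I.val.map (fun i => (Pi.single i 1 : Fin n → ℝ))) ≠ 0 := by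
      rw [Sd_iter_add, Pi.add_apply]
      intro h
      exact hne (CharTwo.add_eq_zero.1 h)
    have hm : ∀ x ∈ I.val.map (fun i => (Pi.single i 1 : Fin n → ℝ)), x ∈ face I := by
      intro x hx
      obtain ⟨i, hi, rfl⟩ := Multiset.mem_map.1 hx
      exact single_mem_face I i hi
    obtain ⟨t, ht, -, htC, -⟩ := Sd_iter_support _ (face I) (face_convex I) k 1 (f + g) _ le_rfl hm
      (fun x hx y hy => simplex_dist (hm x hx).1 (hm y hy).1) h1
    apply ht
    rw [Pi.add_apply, hfg t htC]
    exact CharTwo.add_self_eq_zero _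
  have hzero : (Sd bary)^[k] (0 : Multiset (Fin n → ℝ) → ZMod 2) = 0 := by
    have := Sd_iter_add bary k (0 : Multiset (Fin n → ℝ) → ZMod 2) 0
    simpa using this
  induction I using Finset.induction_on with
  | empty =>
    have : ∀ k : ℕ, ∀ f : Multiset (Fin n → ℝ) → ZMod 2, (Sd bary)^[k] f 0 = f 0 := by
      intro k f
      induction k with
      | zero => rfl
      | succ k ih =>
        rw [Function.iterate_succ_apply', ← ih]
        rfl
    simp [this, ind]
  | insert i J hi ih =>
    rw [loc (insert i J) (ind lam (insert i J)) (dd (ind lam J))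
      (fun t ht => (dd_ind lam J i hi t (fun x hx => hlam _ x (ht x hx))).symm)]
    rw [Sd_iter_dd, Finset.insert_val_of_notMem hi, Multiset.map_cons, dd_cons, ih]
    rw [add_eq_left]
    unfold dd
    apply Multiset.sum_eq_zero
    intro y hy
    obtain ⟨x, hx, rfl⟩ := Multiset.mem_map.1 hy
    obtain ⟨j, hj, rfl⟩ := Multiset.mem_map.1 hx
    have hj' : j ∈ J := hj
    have e : (Pi.single i 1 : Fin n → ℝ) ::ₘ
        (J.val.map (fun i => (Pi.single i 1 : Fin n → ℝ))).erase (Pi.single j 1)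
        = ((insert i (J.erase j)).val.map (fun i => (Pi.single i 1 : Fin n → ℝ))) := by
      rw [Finset.insert_val_of_notMem (by simp [hi]), Multiset.map_cons, Finset.erase_val]
      congr 1
      exact (Multiset.map_erase_of_mem (fun i => (Pi.single i 1 : Fin n → ℝ)) J.val hj).symm
    have h0 := loc (insert i (J.erase j)) (ind lam J) 0 (by
      intro t ht
      unfold ind
      rw [if_neg]
      · rfl
      intro h
      have : j ∈ t.map lam := by rw [h]; exact hj
      obtain ⟨x, hx, hxj⟩ := Multiset.mem_map.1 this
      have := hlam _ x (ht x hx)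
      rw [hxj] at this
      rcases Finset.mem_insert.1 this with rfl | h
      · exact hi hj'
      · simp at h)
    rw [hzero] at h0
    rw [← e] at h0
    rw [Pi.zero_apply] at h0
    convert h0

end KKM

/-- open KKM theorem. If A₁, ..., Aₙ are subsets of the standard simplex,
each open in the subspace topology, and every face conv{eᵢ : i ∈ I} is covered by
⋃_{i ∈ I} Aᵢ, then ⋂ᵢ Aᵢ ≠ ∅. -/
theorem open_kkm (n : ℕ) (A : Fin n → Set (Fin n → ℝ))
    (hsub : ∀ i, A i ⊆ stdSimplex ℝ (Fin n))
    (hopen : ∀ i, ∃ U : Set (Fin n → ℝ), IsOpen U ∧ A i = U ∩ stdSimplex ℝ (Fin n))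
    (hcover : ∀ I : Finset (Fin n),
      convexHull ℝ {x | ∃ i ∈ I, x = Pi.single i 1} ⊆ ⋃ i ∈ I, A i) :
    (⋂ i, A i).Nonempty := by
  classical
  rcases Nat.eq_zero_or_pos n with rfl | hn
  · exact ⟨0, by simp⟩
  choose U hU hAU using hopen
  have h1 : ∀ I : Finset (Fin n), ∃ δ > 0, ∀ x ∈ KKM.face I, ∃ i : I, Metric.ball x δ ⊆ U i := by
    intro I
    apply lebesgue_number_lemma_of_metric (c := fun i : I => U i) (KKM.face_compact I) (fun i => hU i)
    intro x hx
    have := hcover I (KKM.face_subset I hx)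
    simp only [Set.mem_iUnion] at this ⊢
    obtain ⟨i, hi, hx⟩ := this
    rw [hAU] at hx
    exact ⟨⟨i, hi⟩, hx.1⟩
  choose δ hδ hball using h1
  obtain ⟨I0, -, hI0⟩ := Finset.exists_min_image (Finset.univ : Finset (Finset (Fin n))) δ
    ⟨∅, Finset.mem_univ _⟩
  have hlab : ∀ x : Fin n → ℝ, ∃ i : Fin n, x ∈ stdSimplex ℝ (Fin n) →
      x i ≠ 0 ∧ Metric.ball x (δ I0) ⊆ U i := by
    intro x
    by_cases hx : x ∈ stdSimplex ℝ (Fin n)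
    · obtain ⟨i, hi⟩ := hball (Finset.univ.filter (fun i => x i ≠ 0)) x ⟨hx, by simp⟩
      refine ⟨i, fun _ => ⟨(Finset.mem_filter.1 i.2).2, ?_⟩⟩
      exact (Metric.ball_subset_ball (hI0 _ (Finset.mem_univ _))).trans hi
    · exact ⟨⟨0, hn⟩, fun h => absurd h hx⟩
  choose lam hlam using hlab
  have hn1 : (1 : ℝ) ≤ n := by exact_mod_cast hn
  have hr0 : 0 ≤ 1 - 1 / (n : ℝ) := by
    rw [sub_nonneg, div_le_one (by linarith)]
    exact hn1
  have hr1 : 1 - 1 / (n : ℝ) < 1 := by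
    have : 0 < 1 / (n : ℝ) := by positivity
    linarith
  obtain ⟨k, hk⟩ := exists_pow_lt_of_lt_one (hδ I0) hr1
  have hS := KKM.sperner lam (fun I x hx => by
    by_contra h
    exact (hlam x hx.1).1 (hx.2 _ h)) k Finset.univ
  have hm : ∀ x ∈ (Finset.univ : Finset (Fin n)).val.map (fun i => (Pi.single i 1 : Fin n → ℝ)),
      x ∈ stdSimplex ℝ (Fin n) := by
    intro x hx
    obtain ⟨i, hi, rfl⟩ := Multiset.mem_map.1 hx
    exact single_mem_stdSimplex ℝ i
  obtain ⟨t, ht, -, htC, htD⟩ := KKM.Sd_iter_support n (stdSimplex ℝ (Fin n))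
    (convex_stdSimplex ℝ _) k 1 _ _ (by simp) hm
    (fun x hx y hy => KKM.simplex_dist (hm x hx) (hm y hy)) (by rw [hS]; exact one_ne_zero)
  have hmap : t.map lam = (Finset.univ : Finset (Fin n)).val := by
    by_contra h
    exact ht (by unfold KKM.ind; exact if_neg h)
  have hex : ∀ i, ∃ y ∈ t, lam y = i := by
    intro i
    have : i ∈ t.map lam := by rw [hmap]; exact Finset.mem_univ i
    exact Multiset.mem_map.1 this
  obtain ⟨x, hx, -⟩ := hex ⟨0, hn⟩
  refine ⟨x, Set.mem_iInter.2 fun i => ?_⟩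
  obtain ⟨y, hy, rfl⟩ := hex i
  rw [hAU]
  refine ⟨(hlam y (htC y hy)).2 ?_, htC x hx⟩
  rw [Metric.mem_ball]
  have := htD x hx y hy
  rw [mul_one] at this
  exact this.trans_lt hk
end

section
/- Main theorem (upper bound): For k ≥ 4, every family F of nonempty compact convex sets in the plane that contains no C(k) subfamily can be pierced by k−2 lines. -/
open Set

noncomputable section

abbrev Plane := EuclideanSpace ℝ (Fin 2)

/-- A line in the plane: a point plus a nonzero direction. -/
def IsLine (L : Set Plane) : Prop :=
  ∃ p v : Plane, v ≠ 0 ∧ L = {x | ∃ t : ℝ, x = p + t • v}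

/-- A `C(k)` family: `k` distinct sets such that the convex hulls of consecutive
unions are disjoint whenever the index pairs (mod `k`) are disjoint. -/
def IsCk (k : ℕ) [NeZero k] (F : Fin k → Set Plane) : Prop :=
  Function.Injective F ∧
  ∀ i j : Fin k, Disjoint ({i, i + 1} : Finset (Fin k)) ({j, j + 1} : Finset (Fin k)) →
    convexHull ℝ (F i ∪ F (i + 1)) ∩ convexHull ℝ (F j ∪ F (j + 1)) = ∅

/-! ### Part 1: the balancing functions -/

/-- Penalised extent of one set. -/
def al (ε P σ τ : ℝ) (S : Set Plane) (s u : ℝ) : ℝ :=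
  sSup ((fun p : Plane => σ * p 0 - u * max (τ * (p 1 - s)) ε) '' S) +
    sSup ((fun p : Plane => P * max 0 (ε - τ * (p 1 - s))) '' S)

lemma cont0 : Continuous (fun p : Plane => p 0) := by fun_prop
lemma cont1 : Continuous (fun p : Plane => p 1) := by fun_prop

lemma al_cont (ε P σ τ : ℝ) (S : Set Plane) (hS : IsCompact S) :
    Continuous (fun q : ℝ × ℝ => al ε P σ τ S q.1 q.2) := by
  unfold al
  apply Continuous.add
  · apply hS.continuous_sSup (f := fun (q : ℝ × ℝ) (p : Plane) =>
      σ * p 0 - q.2 * max (τ * (p 1 - q.1)) ε)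
    unfold Function.HasUncurry.uncurry
    simp only [Function.hasUncurryInduction]
    fun_prop
  · apply hS.continuous_sSup (f := fun (q : ℝ × ℝ) (p : Plane) =>
      P * max 0 (ε - τ * (p 1 - q.1)))
    unfold Function.HasUncurry.uncurry
    simp only [Function.hasUncurryInduction]
    fun_prop

lemma le_sup_of {S : Set Plane} (hS : IsCompact S) {f : Plane → ℝ} (hf : Continuous f)
    {p : Plane} (hp : p ∈ S) : f p ≤ sSup (f '' S) :=
  le_csSup (hS.image hf).bddAbove (mem_image_of_mem f hp)

lemma sup_le_of {S : Set Plane} (hS : S.Nonempty) {f : Plane → ℝ} {c : ℝ}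
    (h : ∀ p ∈ S, f p ≤ c) : sSup (f '' S) ≤ c := by
  apply csSup_le (hS.image f)
  rintro _ ⟨p, hp, rfl⟩
  exact h p hp

lemma c_main (ε σ τ s u : ℝ) :
    Continuous (fun p : Plane => σ * p 0 - u * max (τ * (p 1 - s)) ε) := by fun_prop
lemma c_pen (ε P τ s : ℝ) :
    Continuous (fun p : Plane => P * max 0 (ε - τ * (p 1 - s))) := by fun_prop

lemma al_mono {ε P σ τ : ℝ} {S : Set Plane} (hS : IsCompact S) (hne : S.Nonempty) {s u u' : ℝ}
    (h : u ≤ u') : al ε P σ τ S s u' ≤ al ε P σ τ S s u - ε * (u' - u) := by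
  unfold al
  have : sSup ((fun p : Plane => σ * p 0 - u' * max (τ * (p 1 - s)) ε) '' S) ≤
      sSup ((fun p : Plane => σ * p 0 - u * max (τ * (p 1 - s)) ε) '' S) - ε * (u' - u) := by
    apply sup_le_of hne
    intro p hp
    have h1 := le_sup_of hS (c_main ε σ τ s u) hp
    have h2 : ε ≤ max (τ * (p 1 - s)) ε := le_max_right _ _
    simp only at h1
    nlinarith
  linarith

/-- pointwise lower bound -/
lemma al_ge {ε P σ τ : ℝ} {S : Set Plane} (hS : IsCompact S) {s u : ℝ}
    {p q : Plane} (hp : p ∈ S) (hq : q ∈ S) :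
    σ * p 0 - u * max (τ * (p 1 - s)) ε + P * max 0 (ε - τ * (q 1 - s)) ≤ al ε P σ τ S s u :=
  add_le_add (le_sup_of hS (c_main ε σ τ s u) hp) (le_sup_of hS (c_pen ε P τ s) hq)

/-- the minimum over the family -/
def AA (G : Finset (Set Plane)) (hG : G.Nonempty) (ε P σ τ s u : ℝ) : ℝ :=
  G.inf' hG (fun S => al ε P σ τ S s u)

structure Good (G : Finset (Set Plane)) (M : ℝ) : Prop where
  ne : ∀ S ∈ G, S.Nonempty
  cpt : ∀ S ∈ G, IsCompact S
  conv : ∀ S ∈ G, Convex ℝ S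
  b0 : ∀ S ∈ G, ∀ p ∈ S, |p 0| ≤ M
  b1 : ∀ S ∈ G, ∀ p ∈ S, |p 1| ≤ M

section
variable {G : Finset (Set Plane)} (hG : G.Nonempty) {M : ℝ} (hM : Good G M)

lemma AA_cont (hM : Good G M) (ε P σ τ : ℝ) :
    Continuous (fun q : ℝ × ℝ => AA G hG ε P σ τ q.1 q.2) := by
  unfold AA
  apply Continuous.finset_inf'_apply
  intro S hS
  exact al_cont ε P σ τ S (hM.cpt S hS)

lemma AA_mono (hM : Good G M) {ε P σ τ s u u' : ℝ} (h : u ≤ u') :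
    AA G hG ε P σ τ s u' ≤ AA G hG ε P σ τ s u - ε * (u' - u) := by
  obtain ⟨S, hS, h1⟩ := G.exists_mem_eq_inf' hG (fun S => al ε P σ τ S s u)
  have h2 : AA G hG ε P σ τ s u = al ε P σ τ S s u := h1
  rw [h2]
  exact (Finset.inf'_le _ hS).trans (al_mono (hM.cpt S hS) (hM.ne S hS) h)

def Phi (G : Finset (Set Plane)) (hG : G.Nonempty) (ε P σ s u : ℝ) : ℝ :=
  AA G hG ε P σ 1 s u - AA G hG ε P σ (-1) s (-u)

lemma Phi_cont (hM : Good G M) (ε P σ : ℝ) :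
    Continuous (fun q : ℝ × ℝ => Phi G hG ε P σ q.1 q.2) := by
  unfold Phi
  have h1 := AA_cont hG hM ε P σ 1
  have h2 := AA_cont hG hM ε P σ (-1)
  exact h1.sub (h2.comp (g := fun q : ℝ × ℝ => AA G hG ε P σ (-1) q.1 q.2)
    (f := fun q : ℝ × ℝ => (q.1, -q.2)) (by fun_prop))

lemma Phi_mono (hM : Good G M) {ε P σ s u u' : ℝ} (h : u ≤ u') :
    Phi G hG ε P σ s u' ≤ Phi G hG ε P σ s u - 2 * ε * (u' - u) := by
  unfold Phi
  have h1 := AA_mono hG hM (ε := ε) (P := P) (σ := σ) (τ := 1) (s := s) h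
  have h2 := AA_mono hG hM (ε := ε) (P := P) (σ := σ) (τ := -1) (s := s) (neg_le_neg h)
  linarith

lemma root_exists {f : ℝ → ℝ → ℝ} (hf : Continuous (fun q : ℝ × ℝ => f q.1 q.2)) {δ : ℝ}
    (hδ : 0 < δ) (hm : ∀ s u u', u ≤ u' → f s u' ≤ f s u - δ * (u' - u)) :
    ∃ z : ℝ → ℝ, Continuous z ∧ (∀ s, f s (z s) = 0) := by
  have hsm : ∀ s u u', u < u' → f s u' < f s u := by
    intro s u u' h
    have := hm s u u' h.le
    have h2 : 0 < δ * (u' - u) := mul_pos hδ (by linarith)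
    linarith
  have hex : ∀ s, ∃ z, f s z = 0 := by
    intro s
    have hc : Continuous (f s) := hf.comp (g := fun q : ℝ × ℝ => f q.1 q.2)
      (f := fun u : ℝ => (s, u)) (by fun_prop)
    set K := |f s 0| / δ with hK
    have hK0 : 0 ≤ K := by positivity
    have hKd : δ * K = |f s 0| := by rw [hK]; field_simp
    have h1 := hm s 0 K hK0
    have h2 := hm s (-K) 0 (by linarith)
    have h3 := le_abs_self (f s 0)
    have h4 := neg_abs_le (f s 0)
    have := intermediate_value_Icc' (f := f s) (a := -K) (b := K) (by linarith) hc.continuousOn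
    obtain ⟨z, _, hz⟩ := this (show (0:ℝ) ∈ Icc (f s K) (f s (-K)) from
      ⟨by linarith, by linarith⟩)
    exact ⟨z, hz⟩
  choose z hz using hex
  refine ⟨z, ?_, hz⟩
  rw [continuous_iff_continuousAt]
  intro s0
  have hcs : ∀ u, Continuous (fun s => f s u) := fun u => hf.comp
    (g := fun q : ℝ × ℝ => f q.1 q.2) (f := fun s : ℝ => (s, u)) (by fun_prop)
  rw [ContinuousAt, tendsto_order]
  constructor
  · intro a ha
    have h1 : 0 < f s0 a := by have := hsm s0 a _ ha; rwa [hz] at this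
    filter_upwards [(hcs a).continuousAt.eventually (lt_mem_nhds h1)] with s hs
    by_contra hcon
    push Not at hcon
    rcases hcon.lt_or_eq with h | h
    · have := hsm s _ _ h; rw [hz] at this; linarith
    · rw [← h, hz] at hs; linarith
  · intro a ha
    have h1 : f s0 a < 0 := by have := hsm s0 _ _ ha; rwa [hz] at this
    filter_upwards [(hcs a).continuousAt.eventually (gt_mem_nhds h1)] with s hs
    by_contra hcon
    push Not at hcon
    rcases hcon.lt_or_eq with h | h
    · have := hsm s _ _ h; rw [hz] at this; linarith
    · rw [h, hz] at hs; linarith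

lemma sig_bound {σ x M : ℝ} (hσ : σ = 1 ∨ σ = -1) (h : |x| ≤ M) : -M ≤ σ * x ∧ σ * x ≤ M := by
  have := abs_le.1 h
  rcases hσ with rfl | rfl <;> constructor <;> linarith

/-- unpenalised upper bound at u ≥ 0 -/
lemma AA_le (hM : Good G M) {ε P σ τ s u : ℝ} (hσ : σ = 1 ∨ σ = -1)
    (hu : 0 ≤ u) {S : Set Plane} (hS : S ∈ G) (hh : ∀ p ∈ S, ε ≤ τ * (p 1 - s)) :
    AA G hG ε P σ τ s u ≤ M - ε * u := by
  refine (Finset.inf'_le _ hS).trans ?_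
  have h1 : sSup ((fun p : Plane => σ * p 0 - u * max (τ * (p 1 - s)) ε) '' S) ≤ M - ε * u := by
    apply sup_le_of (hM.ne S hS)
    intro p hp
    have h2 : ε ≤ max (τ * (p 1 - s)) ε := le_max_right _ _
    have := sig_bound hσ (hM.b0 S hS p hp)
    nlinarith
  have h2 : sSup ((fun p : Plane => P * max 0 (ε - τ * (p 1 - s))) '' S) ≤ 0 := by
    apply sup_le_of (hM.ne S hS)
    intro p hp
    rw [max_eq_left (by linarith [hh p hp])]
    simp
  unfold al
  linarith

lemma AA_attained (ε P σ τ s u : ℝ) : ∃ S ∈ G, AA G hG ε P σ τ s u = al ε P σ τ S s u :=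
  G.exists_mem_eq_inf' hG (fun S => al ε P σ τ S s u)

lemma AA_ge (hM : Good G M) {ε P σ τ s u : ℝ} (hP : 0 ≤ P) (hσ : σ = 1 ∨ σ = -1)
    (hu : u ≤ 0) : -M - ε * u ≤ AA G hG ε P σ τ s u := by
  obtain ⟨S, hS, h⟩ := AA_attained hG ε P σ τ s u
  rw [h]
  obtain ⟨p, hp⟩ := hM.ne S hS
  refine le_trans ?_ (al_ge (hM.cpt S hS) hp hp)
  have h2 : ε ≤ max (τ * (p 1 - s)) ε := le_max_right _ _
  have := sig_bound hσ (hM.b0 S hS p hp)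
  have h3 : 0 ≤ P * max 0 (ε - τ * (p 1 - s)) := mul_nonneg hP (le_max_left _ _)
  nlinarith

/-- general lower bound and penalised lower bound -/
lemma al_ge_pen (hM : Good G M) {ε P σ τ s u U H : ℝ} (hP : 0 ≤ P) (hε : 0 < ε)
    (hσ : σ = 1 ∨ σ = -1) (hu : |u| ≤ U) {S : Set Plane} (hS : S ∈ G)
    (hH : ∀ p ∈ S, τ * (p 1 - s) ≤ H) (hH' : ε ≤ H) {q : Plane} (hq : q ∈ S) :
    -M - U * H + P * max 0 (ε - τ * (q 1 - s)) ≤ al ε P σ τ S s u := by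
  refine le_trans ?_ (al_ge (hM.cpt S hS) hq hq)
  have h2 : ε ≤ max (τ * (q 1 - s)) ε := le_max_right _ _
  have h3 : max (τ * (q 1 - s)) ε ≤ H := max_le (hH q hq) hH'
  have := sig_bound hσ (hM.b0 S hS q hq)
  have h4 : u * max (τ * (q 1 - s)) ε ≤ U * H := by
    calc u * max (τ * (q 1 - s)) ε ≤ |u| * max (τ * (q 1 - s)) ε :=
          mul_le_mul_of_nonneg_right (le_abs_self u) (by linarith)
      _ ≤ U * H := mul_le_mul hu h3 (by linarith) ((abs_nonneg u).trans hu)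
  linarith

lemma al_exact_le {ε P σ τ s u : ℝ} (hP : |u| ≤ P) {S : Set Plane} (hS : IsCompact S)
    {p : Plane} (hp : p ∈ S) : σ * p 0 - u * (τ * (p 1 - s)) ≤ al ε P σ τ S s u := by
  refine le_trans ?_ (al_ge hS hp hp)
  rcases le_total ε (τ * (p 1 - s)) with h | h
  · rw [max_eq_left h, max_eq_left (by linarith)]; simp
  · rw [max_eq_right h, max_eq_right (by linarith)]
    have h1 := (abs_le.1 hP)
    nlinarith

lemma AA_exact_le (hM : Good G M) {ε P σ τ s u : ℝ} {S : Set Plane} (hS : S ∈ G)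
    (hh : ∀ p ∈ S, ε ≤ τ * (p 1 - s)) :
    ∃ p ∈ S, AA G hG ε P σ τ s u ≤ σ * p 0 - u * (τ * (p 1 - s)) := by
  obtain ⟨p, hp, hmax⟩ := (hM.cpt S hS).exists_isMaxOn (hM.ne S hS)
    (c_main ε σ τ s u).continuousOn
  refine ⟨p, hp, (Finset.inf'_le _ hS).trans ?_⟩
  have h1 : sSup ((fun p : Plane => σ * p 0 - u * max (τ * (p 1 - s)) ε) '' S) ≤
      σ * p 0 - u * (τ * (p 1 - s)) := by
    apply sup_le_of (hM.ne S hS)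
    intro q hq
    have := hmax hq
    simp only [mem_ofPred_eq] at this
    rwa [max_eq_left (hh p hp)] at this
  have h2 : sSup ((fun p : Plane => P * max 0 (ε - τ * (p 1 - s))) '' S) ≤ 0 := by
    apply sup_le_of (hM.ne S hS)
    intro p hp
    rw [max_eq_left (by linarith [hh p hp])]
    simp
  unfold al
  linarith
end

lemma balance {G : Finset (Set Plane)} (hG : G.Nonempty) {M : ℝ} (hM : Good G M) {ε P : ℝ}
    (hε : 0 < ε) (hM0 : 0 < M) (hP : 2 * M ≤ P * ε) :
    ∃ s u : ℝ, |s| ≤ M + ε ∧ Phi G hG ε P 1 s u = 0 ∧ Phi G hG ε P (-1) s (-u) = 0 := by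
  have hP0 : 0 < P := by
    by_contra h
    push Not at h
    nlinarith
  have hroot : ∀ σ, ∃ z : ℝ → ℝ, Continuous z ∧ (∀ s, Phi G hG ε P σ s (z s) = 0) := by
    intro σ
    exact root_exists (f := fun s u => Phi G hG ε P σ s u) (Phi_cont hG hM ε P σ)
      (δ := 2 * ε) (by linarith) (fun s u u' h => Phi_mono hG hM h)
  have pen : ∀ σ τ s : ℝ, (σ = 1 ∨ σ = -1) → (∀ S ∈ G, ∀ p ∈ S, τ * (p 1 - s) ≤ -ε) →
      -M + 4 * M ≤ AA G hG ε P σ τ s 0 := by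
    intro σ τ s hσ h
    obtain ⟨S, hS, h1⟩ := AA_attained hG ε P σ τ s 0
    rw [h1]
    obtain ⟨p, hp⟩ := hM.ne S hS
    refine le_trans ?_ (al_ge (hM.cpt S hS) hp hp)
    have := sig_bound hσ (hM.b0 S hS p hp)
    have h2 : 2 * ε ≤ max 0 (ε - τ * (p 1 - s)) :=
      le_trans (by linarith [h S hS p hp]) (le_max_right _ _)
    have h3 := mul_le_mul_of_nonneg_left h2 hP0.le
    linarith
  obtain ⟨S, hS⟩ := id hG
  have hi : ∀ σ : ℝ, (σ = 1 ∨ σ = -1) → 0 < Phi G hG ε P σ (M + ε) 0 := by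
    intro σ hσ
    have h1 := pen σ 1 (M + ε) hσ (by
      intro S hS p hp
      have := abs_le.1 (hM.b1 S hS p hp)
      linarith)
    have h2 := AA_le hG hM (ε := ε) (P := P) (τ := -1) (s := M + ε) hσ (u := 0) le_rfl hS (by
      intro p hp
      have := abs_le.1 (hM.b1 S hS p hp)
      linarith)
    unfold Phi
    rw [neg_zero]
    linarith
  have lo : ∀ σ : ℝ, (σ = 1 ∨ σ = -1) → Phi G hG ε P σ (-(M + ε)) 0 < 0 := by
    intro σ hσ
    have h1 := pen σ (-1) (-(M + ε)) hσ (by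
      intro S hS p hp
      have := abs_le.1 (hM.b1 S hS p hp)
      linarith)
    have h2 := AA_le hG hM (ε := ε) (P := P) (τ := 1) (s := -(M + ε)) hσ (u := 0) le_rfl hS (by
      intro p hp
      have := abs_le.1 (hM.b1 S hS p hp)
      linarith)
    unfold Phi
    rw [neg_zero]
    linarith
  obtain ⟨z1, hc1, hz1⟩ := hroot 1
  obtain ⟨z2, hc2, hz2⟩ := hroot (-1)
  have hpos : ∀ σ s z : ℝ, 0 < Phi G hG ε P σ s 0 → Phi G hG ε P σ s z = 0 → 0 ≤ z := by
    intro σ s z h h'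
    by_contra hc
    push Not at hc
    have := Phi_mono hG hM (ε := ε) (P := P) (σ := σ) (s := s) hc.le
    nlinarith
  have hneg : ∀ σ s z : ℝ, Phi G hG ε P σ s 0 < 0 → Phi G hG ε P σ s z = 0 → z ≤ 0 := by
    intro σ s z h h'
    by_contra hc
    push Not at hc
    have := Phi_mono hG hM (ε := ε) (P := P) (σ := σ) (s := s) hc.le
    nlinarith
  have a1 := hpos 1 _ _ (hi 1 (Or.inl rfl)) (hz1 (M + ε))
  have a2 := hpos (-1) _ _ (hi (-1) (Or.inr rfl)) (hz2 (M + ε))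
  have b1 := hneg 1 _ _ (lo 1 (Or.inl rfl)) (hz1 (-(M + ε)))
  have b2 := hneg (-1) _ _ (lo (-1) (Or.inr rfl)) (hz2 (-(M + ε)))
  obtain ⟨s, hs, h0⟩ := intermediate_value_Icc (f := fun s => z1 s + z2 s)
    (a := -(M + ε)) (b := M + ε) (by linarith) (hc1.add hc2).continuousOn
    (show (0:ℝ) ∈ _ from ⟨by linarith, by linarith⟩)
  refine ⟨s, z1 s, abs_le.2 hs, hz1 s, ?_⟩
  have : -z1 s = z2 s := by simp only at h0; linarith
  rw [this]
  exact hz2 s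

/-- Core geometric statement. -/
lemma core {G : Finset (Set Plane)} (hG : G.Nonempty) {M : ℝ} (hM : Good G M) (hM0 : 0 < M)
    {ε : ℝ} (hε : 0 < ε) :
    ∃ s u A B : ℝ,
      (∀ S ∈ G, ¬ (∀ p ∈ S, ε ≤ p 1 - s) ∧ ¬ (∀ p ∈ S, ε ≤ s - p 1)) ∨
      ((∀ S ∈ G, ((∀ p ∈ S, ε ≤ p 1 - s) ∨ (∀ p ∈ S, ε ≤ s - p 1)) →
          (∃ p ∈ S, A ≤ p 0 - u * (p 1 - s)) ∧ (∃ p ∈ S, p 0 - u * (p 1 - s) ≤ B)) ∧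
       (A < B →
          (∃ S ∈ G, ∀ p ∈ S, s < p 1 ∧ p 0 - u * (p 1 - s) ≤ A) ∧
          (∃ S ∈ G, ∀ p ∈ S, s < p 1 ∧ B ≤ p 0 - u * (p 1 - s)) ∧
          (∃ S ∈ G, ∀ p ∈ S, p 1 < s ∧ p 0 - u * (p 1 - s) ≤ A) ∧
          (∃ S ∈ G, ∀ p ∈ S, p 1 < s ∧ B ≤ p 0 - u * (p 1 - s)))) := by
  set U := M / ε with hU
  have hU0 : 0 < U := by positivity
  have hUe : U * ε = M := by rw [hU]; field_simp
  set H := 2 * M + ε with hH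
  have hH0 : 0 < H := by positivity
  set P := (2 * M + 2 * U * H) / ε + U with hPdef
  have hP0 : 0 < P := by positivity
  have hPU : U ≤ P := by
    have : 0 < (2 * M + 2 * U * H) / ε := by positivity
    linarith
  have hPe : 2 * M + 2 * U * H ≤ P * ε := by
    have : P * ε = 2 * M + 2 * U * H + U * ε := by rw [hPdef]; field_simp
    nlinarith
  obtain ⟨s, u, hs, e1, e2⟩ := balance hG hM hε hM0 (P := P)
    (by have : 0 < U * H := by positivity
        linarith)
  have one : (1:ℝ) = 1 ∨ (1:ℝ) = -1 := Or.inl rfl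
  have mone : (-1:ℝ) = 1 ∨ (-1:ℝ) = -1 := Or.inr rfl
  unfold Phi at e1 e2
  rw [neg_neg] at e2
  set A := AA G hG ε P 1 1 s u with hA
  set A' := AA G hG ε P 1 (-1) s (-u) with hA'
  set C := AA G hG ε P (-1) 1 s (-u) with hC
  set C' := AA G hG ε P (-1) (-1) s u with hC'
  by_cases hone : ∀ S ∈ G, ¬ (∀ p ∈ S, ε ≤ p 1 - s) ∧ ¬ (∀ p ∈ S, ε ≤ s - p 1)
  · exact ⟨s, u, A, -C, Or.inl hone⟩
  refine ⟨s, u, A, -C, Or.inr ?_⟩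
  have hu : |u| ≤ U := by
    have key : ε * |u| ≤ M := by
      push Not at hone
      obtain ⟨S, hS, h⟩ := hone
      have hcase : (∀ p ∈ S, ε ≤ 1 * (p 1 - s)) ∨ (∀ p ∈ S, ε ≤ (-1) * (p 1 - s)) := by
        by_cases h1 : ∀ p ∈ S, ε ≤ p 1 - s
        · left; intro p hp; linarith [h1 p hp]
        · right; intro p hp
          push Not at h1
          linarith [h h1 p hp]
      rcases le_total 0 u with hu | hu
      · rw [abs_of_nonneg hu]
        rcases hcase with hc | hc
        · have h1 := AA_le hG hM (P := P) one hu hS hc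
          have h2 := AA_ge hG hM (ε := ε) (τ := -1) (s := s) hP0.le one (u := -u) (by linarith)
          linarith
        · have h1 := AA_le hG hM (P := P) mone hu hS hc
          have h2 := AA_ge hG hM (ε := ε) (τ := 1) (s := s) hP0.le mone (u := -u) (by linarith)
          linarith
      · rw [abs_of_nonpos hu]
        rcases hcase with hc | hc
        · have h1 := AA_le hG hM (P := P) mone (u := -u) (by linarith) hS hc
          have h2 := AA_ge hG hM (ε := ε) (τ := -1) (s := s) hP0.le mone hu
          linarith
        · have h1 := AA_le hG hM (P := P) one (u := -u) (by linarith) hS hc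
          have h2 := AA_ge hG hM (ε := ε) (τ := 1) (s := s) hP0.le one hu
          linarith
    rw [hU, le_div_iff₀ hε]
    linarith
  have hu' : |-u| ≤ U := by rwa [abs_neg]
  constructor
  · intro S hS h
    rcases h with h | h
    · have h1 : ∀ p ∈ S, ε ≤ 1 * (p 1 - s) := fun p hp => by linarith [h p hp]
      obtain ⟨p, hp, k1⟩ := AA_exact_le hG hM (P := P) (σ := 1) (u := u) hS h1
      obtain ⟨q, hq, k2⟩ := AA_exact_le hG hM (P := P) (σ := -1) (u := -u) hS h1
      exact ⟨⟨p, hp, by linarith⟩, ⟨q, hq, by linarith⟩⟩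
    · have h1 : ∀ p ∈ S, ε ≤ (-1) * (p 1 - s) := fun p hp => by linarith [h p hp]
      obtain ⟨p, hp, k1⟩ := AA_exact_le hG hM (P := P) (σ := 1) (u := -u) hS h1
      obtain ⟨q, hq, k2⟩ := AA_exact_le hG hM (P := P) (σ := -1) (u := u) hS h1
      exact ⟨⟨p, hp, by linarith⟩, ⟨q, hq, by linarith⟩⟩
  · intro hAB
    have hHb : ∀ τ : ℝ, (τ = 1 ∨ τ = -1) → ∀ S ∈ G, ∀ p ∈ S, τ * (p 1 - s) ≤ H := by
      intro τ hτ S hS p hp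
      have h1 := abs_le.1 (hM.b1 S hS p hp)
      have h2 := abs_le.1 hs
      rcases hτ with rfl | rfl <;> linarith
    have lower : ∀ σ τ v : ℝ, (σ = 1 ∨ σ = -1) → (τ = 1 ∨ τ = -1) → |v| ≤ U →
        -M - U * H ≤ AA G hG ε P σ τ s v := by
      intro σ τ v hσ hτ hv
      obtain ⟨S, hS, h1⟩ := AA_attained hG ε P σ τ s v
      obtain ⟨q, hq⟩ := hM.ne S hS
      have := al_ge_pen hM hP0.le hε hσ hv hS (hHb τ hτ S hS) (by linarith) hq
      have h3 : 0 ≤ P * max 0 (ε - τ * (q 1 - s)) := mul_nonneg hP0.le (le_max_left _ _)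
      linarith
    have fin : ∀ σ τ v : ℝ, (σ = 1 ∨ σ = -1) → (τ = 1 ∨ τ = -1) → |v| ≤ U →
        AA G hG ε P σ τ s v < M + U * H → ∃ S ∈ G, ∀ p ∈ S, 0 < τ * (p 1 - s) ∧
          σ * p 0 - v * (τ * (p 1 - s)) ≤ AA G hG ε P σ τ s v := by
      intro σ τ v hσ hτ hv hlt
      obtain ⟨S, hS, h1⟩ := AA_attained hG ε P σ τ s v
      refine ⟨S, hS, fun p hp => ⟨?_, ?_⟩⟩
      · by_contra hc
        push Not at hc
        have := al_ge_pen hM hP0.le hε hσ hv hS (hHb τ hτ S hS) (by linarith) hp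
        have h2 : ε ≤ max 0 (ε - τ * (p 1 - s)) := le_trans (by linarith) (le_max_right _ _)
        have h3 := mul_le_mul_of_nonneg_left h2 hP0.le
        linarith
      · rw [h1]
        exact al_exact_le (hv.trans hPU) (hM.cpt S hS) hp
    have l1 := lower 1 1 u one one hu
    have l3 := lower (-1) 1 (-u) mone one hu'
    obtain ⟨S1, m1, f1⟩ := fin 1 1 u one one hu (by linarith)
    obtain ⟨S2, m2, f2⟩ := fin (-1) 1 (-u) mone one hu' (by linarith)
    obtain ⟨S3, m3, f3⟩ := fin 1 (-1) (-u) one mone hu' (by linarith)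
    obtain ⟨S4, m4, f4⟩ := fin (-1) (-1) u mone mone hu (by linarith)
    refine ⟨⟨S1, m1, fun p hp => ?_⟩, ⟨S2, m2, fun p hp => ?_⟩, ⟨S3, m3, fun p hp => ?_⟩,
      ⟨S4, m4, fun p hp => ?_⟩⟩
    · have := f1 p hp; constructor <;> linarith [this.1, this.2]
    · have := f2 p hp; constructor <;> linarith [this.1, this.2]
    · have := f3 p hp; constructor <;> linarith [this.1, this.2]
    · have := f4 p hp; constructor <;> linarith [this.1, this.2]

/-! ### Part 3: combinatorics -/

lemma greedy {α : Type*} (lo hi : α → ℝ) (n : ℕ) : ∀ G : Finset α, G.card ≤ n →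
    (∀ S ∈ G, lo S ≤ hi S) → ∃ (l : List α) (t : List ℝ), l.length = t.length ∧
      (∀ x ∈ l, x ∈ G) ∧ l.Pairwise (fun a b => hi a < lo b) ∧
      ∀ S ∈ G, ∃ x ∈ t, lo S ≤ x ∧ x ≤ hi S := by
  classical
  induction n with
  | zero =>
    intro G hG _
    have : G = ∅ := Finset.card_eq_zero.1 (by omega)
    subst this
    exact ⟨[], [], rfl, by simp, by simp, by simp⟩
  | succ n ih =>
    intro G hG h
    by_cases hne : G.Nonempty
    · obtain ⟨S0, hS0, hmin⟩ := G.exists_min_image hi hne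
      have hlt : (G.filter (fun S => hi S0 < lo S)).card < G.card := by
        apply Finset.card_lt_card
        rw [Finset.filter_ssubset]
        exact ⟨S0, hS0, by simpa using h S0 hS0⟩
      obtain ⟨l, t, h1, h2, h3, h4⟩ := ih (G.filter (fun S => hi S0 < lo S)) (by omega)
        (fun S hS => h S (Finset.mem_filter.1 hS).1)
      refine ⟨S0 :: l, hi S0 :: t, by simp [h1], ?_, ?_, ?_⟩
      · intro x hx
        rcases List.mem_cons.1 hx with rfl | hx
        · exact hS0
        · exact (Finset.mem_filter.1 (h2 x hx)).1
      · rw [List.pairwise_cons]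
        exact ⟨fun a ha => (Finset.mem_filter.1 (h2 a ha)).2, h3⟩
      · intro S hS
        by_cases hc : hi S0 < lo S
        · obtain ⟨x, hx, hx'⟩ := h4 S (Finset.mem_filter.2 ⟨hS, hc⟩)
          exact ⟨x, List.mem_cons_of_mem _ hx, hx'⟩
        · exact ⟨hi S0, List.mem_cons_self, not_lt.1 hc, hmin S hS⟩
    · rw [Finset.not_nonempty_iff_eq_empty] at hne
      subst hne
      exact ⟨[], [], rfl, by simp, by simp, by simp⟩

lemma hull_sep (a b : ℝ) {X Y : Set Plane}
    (h : ∀ p ∈ X, ∀ q ∈ Y, a * p 0 + b * p 1 < a * q 0 + b * q 1) :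
    convexHull ℝ X ∩ convexHull ℝ Y = ∅ := by
  have hlin : IsLinearMap ℝ (fun p : Plane => a * p 0 + b * p 1) := by
    constructor
    · intro x y; simp; ring
    · intro c x; simp; ring
  have h1 : ∀ q ∈ Y, ∀ x ∈ convexHull ℝ X, a * x 0 + b * x 1 < a * q 0 + b * q 1 := by
    intro q hq x hx
    exact convexHull_min (fun p hp => h p hp q hq) (convex_halfSpace_lt hlin _) hx
  have h2 : ∀ x ∈ convexHull ℝ X, ∀ y ∈ convexHull ℝ Y,
      a * x 0 + b * x 1 < a * y 0 + b * y 1 := by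
    intro x hx y hy
    exact convexHull_min (fun q hq => h1 q hq x hx) (convex_halfSpace_gt hlin _) hy
  rw [Set.eq_empty_iff_forall_notMem]
  rintro z ⟨hz1, hz2⟩
  exact lt_irrefl _ (h2 z hz1 z hz2)

/-- strict separation along the direction `x - u y` -/
def Rr (u : ℝ) (S T : Set Plane) : Prop :=
  ∀ p ∈ S, ∀ q ∈ T, p 0 - u * p 1 < q 0 - u * q 1

lemma hull_Rr {u : ℝ} {X X' Y Y' : Set Plane} (h1 : Rr u X Y) (h2 : Rr u X Y')
    (h3 : Rr u X' Y) (h4 : Rr u X' Y') :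
    convexHull ℝ (X ∪ X') ∩ convexHull ℝ (Y ∪ Y') = ∅ := by
  apply hull_sep 1 (-u)
  rintro p (hp | hp) q (hq | hq)
  · linarith [h1 p hp q hq]
  · linarith [h2 p hp q hq]
  · linarith [h3 p hp q hq]
  · linarith [h4 p hp q hq]

lemma hull_Rr' {u : ℝ} {X X' Y Y' : Set Plane} (h1 : Rr u Y X) (h2 : Rr u Y' X)
    (h3 : Rr u Y X') (h4 : Rr u Y' X') :
    convexHull ℝ (X ∪ X') ∩ convexHull ℝ (Y ∪ Y') = ∅ := by
  rw [inter_comm]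
  exact hull_Rr h1 h3 h2 h4

lemma cyc (k : ℕ) [NeZero k] (n1 n2 : ℕ) (hn1 : 2 ≤ n1) (hn2 : 2 ≤ n2) (hk : n1 + n2 = k)
    (f g : ℕ → Set Plane) (u : ℝ)
    (fne : ∀ i < n1, (f i).Nonempty) (gne : ∀ i < n2, (g i).Nonempty)
    (hf : ∀ i j, i < j → j < n1 → Rr u (f i) (f j))
    (hg : ∀ i j, i < j → j < n2 → Rr u (g i) (g j))
    (h00 : ∀ j, 1 ≤ j → j < n1 → Rr u (g 0) (f j))
    (h01 : ∀ j, 1 ≤ j → j < n2 → Rr u (f 0) (g j))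
    (h10 : ∀ j, j + 1 < n1 → Rr u (f j) (g (n2 - 1)))
    (h11 : ∀ j, j + 1 < n2 → Rr u (g j) (f (n1 - 1)))
    (hy : ∀ i < n1, ∀ j < n2, ∀ p ∈ g j, ∀ q ∈ f i, p 1 < q 1) :
    IsCk k (fun i : Fin k => if i.val < n1 then f i.val else g (k - 1 - i.val)) := by
  have irr : ∀ S : Set Plane, S.Nonempty → ¬ Rr u S S := by
    rintro S ⟨p, hp⟩ h
    exact lt_irrefl _ (h p hp p hp)
  set Q : ℕ → Set Plane := fun i => if i < n1 then f i else g (k - 1 - i) with hQ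
  have Qf : ∀ i, i < n1 → Q i = f i := fun i hi => by simp [hQ, hi]
  have Qg : ∀ i, n1 ≤ i → Q i = g (k - 1 - i) := fun i hi => by simp [hQ, not_lt.2 hi]
  change IsCk k (fun i : Fin k => Q i.val)
  have hinj : ∀ i j : ℕ, i < j → j < k → Q i ≠ Q j := by
    intro i j hij hj he
    by_cases h1 : j < n1
    · rw [Qf i (by omega), Qf j h1] at he
      have := hf i j hij h1
      rw [he] at this
      exact irr _ (fne j h1) this
    · by_cases h2 : i < n1
      · rw [Qf i h2, Qg j (by omega)] at he
        obtain ⟨p, hp⟩ := fne i h2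
        have := hy i h2 (k - 1 - j) (by omega) p (he ▸ hp) p hp
        exact lt_irrefl _ this
      · rw [Qg i (by omega), Qg j (by omega)] at he
        have := hg (k - 1 - j) (k - 1 - i) (by omega) (by omega)
        rw [he] at this
        exact irr _ (gne _ (by omega)) this
  have main : ∀ i j i' j' : ℕ, i < j → j < k → i' = i + 1 → i' ≠ j →
      (j' = if j = k - 1 then 0 else j + 1) → i ≠ j' →
      convexHull ℝ (Q i ∪ Q i') ∩ convexHull ℝ (Q j ∪ Q j') = ∅ := by
    intro i j i' j' hij hj hi' hne hj' hne'
    subst hi'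
    by_cases hjk : j = k - 1
    · rw [if_pos hjk] at hj'
      subst hj'
      rw [Qf 0 (by omega), Qg j (by omega), show k - 1 - j = 0 by omega]
      by_cases c1 : i + 1 < n1
      · rw [Qf i (by omega), Qf (i + 1) c1]
        exact hull_Rr' (h00 _ (by omega) (by omega)) (hf _ _ (by omega) (by omega))
          (h00 _ (by omega) (by omega)) (hf _ _ (by omega) (by omega))
      · by_cases c2 : i + 1 = n1
        · rw [Qf i (by omega), Qg (i + 1) (by omega)]
          exact hull_Rr' (h00 _ (by omega) (by omega)) (hf _ _ (by omega) (by omega))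
            (hg _ _ (by omega) (by omega)) (h01 _ (by omega) (by omega))
        · rw [Qg i (by omega), Qg (i + 1) (by omega)]
          exact hull_Rr' (hg _ _ (by omega) (by omega)) (h01 _ (by omega) (by omega))
            (hg _ _ (by omega) (by omega)) (h01 _ (by omega) (by omega))
    · rw [if_neg hjk] at hj'
      subst hj'
      by_cases c1 : i + 1 < n1
      · rw [Qf i (by omega), Qf (i + 1) c1]
        by_cases d1 : j + 1 < n1
        · rw [Qf j (by omega), Qf (j + 1) d1]
          exact hull_Rr (hf _ _ (by omega) (by omega)) (hf _ _ (by omega) (by omega))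
            (hf _ _ (by omega) (by omega)) (hf _ _ (by omega) (by omega))
        · by_cases d2 : j + 1 = n1
          · rw [Qf j (by omega), Qg (j + 1) (by omega), show k - 1 - (j + 1) = n2 - 1 by omega]
            exact hull_Rr (hf _ _ (by omega) (by omega)) (h10 _ (by omega))
              (hf _ _ (by omega) (by omega)) (h10 _ (by omega))
          · rw [Qg j (by omega), Qg (j + 1) (by omega), inter_comm]
            apply hull_sep 0 1
            rintro p (hp | hp) q (hq | hq)
            · linarith [hy _ (by omega) _ (by omega) p hp q hq]
            · linarith [hy _ (by omega) _ (by omega) p hp q hq]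
            · linarith [hy _ (by omega) _ (by omega) p hp q hq]
            · linarith [hy _ (by omega) _ (by omega) p hp q hq]
      · rw [Qg j (by omega), Qg (j + 1) (by omega)]
        by_cases c2 : i + 1 = n1
        · rw [Qf i (by omega), Qg (i + 1) (by omega)]
          have e : i = n1 - 1 := by omega
          subst e
          exact hull_Rr' (h11 _ (by omega)) (h11 _ (by omega))
            (hg _ _ (by omega) (by omega)) (hg _ _ (by omega) (by omega))
        · rw [Qg i (by omega), Qg (i + 1) (by omega)]
          exact hull_Rr' (hg _ _ (by omega) (by omega)) (hg _ _ (by omega) (by omega))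
            (hg _ _ (by omega) (by omega)) (hg _ _ (by omega) (by omega))
  constructor
  · intro i j he
    by_contra hne
    rcases lt_or_gt_of_ne (fun h => hne (Fin.ext h) : i.val ≠ j.val) with h | h
    · exact hinj _ _ h j.2 he
    · exact hinj _ _ h i.2 he.symm
  · have hval : ∀ j : Fin k, (j + 1).val = if j.val = k - 1 then 0 else j.val + 1 := by
      intro j
      have hj := j.2
      rw [Fin.val_add, Fin.val_one', Nat.mod_eq_of_lt (show 1 < k by omega)]
      split_ifs with h
      · rw [h, show k - 1 + 1 = k by omega, Nat.mod_self]
      · exact Nat.mod_eq_of_lt (by omega)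
    have half : ∀ i j : Fin k, i.val < j.val →
        Disjoint ({i, i + 1} : Finset (Fin k)) ({j, j + 1} : Finset (Fin k)) →
        convexHull ℝ (Q i.val ∪ Q (i + 1).val) ∩ convexHull ℝ (Q j.val ∪ Q (j + 1).val) = ∅ := by
      intro i j hij hd
      rw [Finset.disjoint_left] at hd
      apply main _ _ _ _ hij j.2
      · rw [hval, if_neg (by have := j.2; omega)]
      · intro h
        have : i + 1 = j := Fin.ext h
        exact hd (a := i + 1) (by simp) (by simp [this])
      · exact hval j
      · intro h
        have : i = j + 1 := Fin.ext h
        exact hd (a := i) (by simp) (by simp [← this])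
    intro i j hd
    rcases lt_trichotomy i.val j.val with h | h | h
    · exact half i j h hd
    · have : i = j := Fin.ext h
      subst this
      simp at hd
    · rw [inter_comm]
      exact half j i h hd.symm

lemma chain (u : ℝ) (m : List (Set Plane)) (S0 S1 : Set Plane) (hm : m.Pairwise (Rr u))
    (h0 : ∀ T ∈ m, Rr u S0 T) (h1 : ∀ T ∈ m, Rr u T S1) (h01 : Rr u S0 S1) :
    ∃ f : ℕ → Set Plane, f 0 = S0 ∧ f (m.length + 1) = S1 ∧
      (∀ i, 1 ≤ i → i ≤ m.length → f i ∈ m) ∧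
      ∀ i j, i < j → j < m.length + 2 → Rr u (f i) (f j) := by
  refine ⟨fun i => if i = 0 then S0 else if i = m.length + 1 then S1 else m.getD (i - 1) ∅,
    by simp, by simp, ?_, ?_⟩
  · intro i hi hi'
    beta_reduce
    rw [if_neg (by omega), if_neg (by omega), List.getD_eq_getElem _ _ (by omega)]
    exact List.getElem_mem _
  · intro i j hij hj
    simp only
    by_cases c0 : i = 0
    · rw [if_pos c0, if_neg (show ¬ j = 0 by omega)]
      by_cases c1 : j = m.length + 1
      · rw [if_pos c1]; exact h01
      · rw [if_neg c1, List.getD_eq_getElem _ _ (by omega)]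
        exact h0 _ (List.getElem_mem _)
    · rw [if_neg c0, if_neg (show ¬ j = 0 by omega), if_neg (show ¬ i = m.length + 1 by omega),
        List.getD_eq_getElem _ _ (by omega)]
      by_cases c1 : j = m.length + 1
      · rw [if_pos c1]; exact h1 _ (List.getElem_mem _)
      · rw [if_neg c1, List.getD_eq_getElem _ _ (by omega)]
        exact List.pairwise_iff_getElem.1 hm _ _ _ _ (by omega)

lemma finlem (k : ℕ) [NeZero k] (hk : 4 ≤ k) {G : Finset (Set Plane)} (hG : G.Nonempty) {M : ℝ}
    (hM : Good G M) (hM0 : 0 < M)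
    (hfree : ¬ ∃ Q : Fin k → Set Plane, (∀ i, Q i ∈ G) ∧ IsCk k Q) {ε : ℝ} (hε : 0 < ε) :
    ∃ l : List (ℝ × ℝ × ℝ), l.length ≤ k - 2 ∧ (∀ v ∈ l, 1 ≤ ‖v‖) ∧
      ∀ S ∈ G, ∃ v ∈ l, ∃ p ∈ S, |v.1 * p 0 + v.2.1 * p 1 - v.2.2| ≤ ε := by
  classical
  obtain ⟨s, u, A, B, hcore⟩ := core hG hM hM0 hε
  have nh : (1:ℝ) ≤ ‖((0:ℝ), (1:ℝ), s)‖ := by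
    have h1 := norm_snd_le ((0:ℝ), (1:ℝ), s)
    have h2 := norm_fst_le ((1:ℝ), s)
    simp only [norm_one] at h1 h2
    linarith
  have nv : ∀ t : ℝ, (1:ℝ) ≤ ‖((1:ℝ), -u, t)‖ := by
    intro t
    have h1 := norm_fst_le ((1:ℝ), -u, t)
    simpa using h1
  -- sets in neither half are close to the horizontal line
  have near : ∀ S ∈ G, ¬ (∀ p ∈ S, ε ≤ p 1 - s) → ¬ (∀ p ∈ S, ε ≤ s - p 1) →
      ∃ p ∈ S, |(0:ℝ) * p 0 + 1 * p 1 - s| ≤ ε := by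
    intro S hS h1 h2
    push Not at h1 h2
    obtain ⟨p, hp, hp'⟩ := h1
    obtain ⟨q, hq, hq'⟩ := h2
    by_cases hc : -ε ≤ p 1 - s
    · exact ⟨p, hp, abs_le.2 ⟨by linarith, by linarith⟩⟩
    · push Not at hc
      obtain ⟨r, hr, hr'⟩ := (hM.conv S hS).isPreconnected.intermediate_value hp hq
        cont1.continuousOn (show s - ε ∈ Icc (p 1) (q 1) from ⟨by linarith, by linarith⟩)
      simp only at hr'
      exact ⟨r, hr, abs_le.2 ⟨by linarith, by linarith⟩⟩
  have hit : ∀ S ∈ G, ∀ t : ℝ, (∃ p ∈ S, p 0 - u * p 1 ≤ t) → (∃ p ∈ S, t ≤ p 0 - u * p 1) →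
      ∃ p ∈ S, |(1:ℝ) * p 0 + (-u) * p 1 - t| ≤ ε := by
    rintro S hS t ⟨p, hp, hp'⟩ ⟨q, hq, hq'⟩
    obtain ⟨r, hr, hr'⟩ := (hM.conv S hS).isPreconnected.intermediate_value hp hq
      (f := fun p : Plane => p 0 - u * p 1) (by fun_prop) (show t ∈ Icc _ _ from ⟨hp', hq'⟩)
    simp only at hr'
    refine ⟨r, hr, ?_⟩
    rw [show (1:ℝ) * r 0 + (-u) * r 1 - t = 0 by linarith]
    simpa using hε.le
  rcases hcore with h1 | ⟨hmid, hAB⟩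
  · refine ⟨[(0, 1, s)], by simp; omega, by simpa using nh, ?_⟩
    intro S hS
    exact ⟨_, List.mem_singleton_self _, near S hS (h1 S hS).1 (h1 S hS).2⟩
  -- shift the thresholds
  set A' := A - u * s with hA'
  set B' := B - u * s with hB'
  have hmid' : ∀ S ∈ G, ((∀ p ∈ S, ε ≤ p 1 - s) ∨ (∀ p ∈ S, ε ≤ s - p 1)) →
      (∃ p ∈ S, A' ≤ p 0 - u * p 1) ∧ (∃ p ∈ S, p 0 - u * p 1 ≤ B') := by
    intro S hS h
    obtain ⟨⟨p, hp, h1⟩, ⟨q, hq, h2⟩⟩ := hmid S hS h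
    exact ⟨⟨p, hp, by linarith⟩, ⟨q, hq, by linarith⟩⟩
  by_cases hlt : A < B
  swap
  · push Not at hlt
    refine ⟨[(0, 1, s), (1, -u, A')], by simp; omega, ?_, ?_⟩
    · intro v hv
      simp only [List.mem_cons, List.not_mem_nil, or_false] at hv
      rcases hv with rfl | rfl
      · exact nh
      · exact nv _
    · intro S hS
      by_cases hc : (∀ p ∈ S, ε ≤ p 1 - s) ∨ (∀ p ∈ S, ε ≤ s - p 1)
      · obtain ⟨h1, ⟨q, hq, h2⟩⟩ := hmid' S hS hc
        exact ⟨(1, -u, A'), by simp, hit S hS A' ⟨q, hq, by linarith⟩ h1⟩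
      · push Not at hc
        exact ⟨(0, 1, s), by simp, near S hS (by push Not; exact hc.1) (by push Not; exact hc.2)⟩
  obtain ⟨⟨S0, mS0, hS0⟩, ⟨S1, mS1, hS1⟩, ⟨T0, mT0, hT0⟩, ⟨T1, mT1, hT1⟩⟩ := hAB hlt
  set ψ : Plane → ℝ := fun p => p 0 - u * p 1 with hψ
  have ψc : Continuous ψ := by rw [hψ]; fun_prop
  set lo : Set Plane → ℝ := fun S => sInf (ψ '' S) with hlo
  set hi : Set Plane → ℝ := fun S => sSup (ψ '' S) with hhi
  have lo_le : ∀ S ∈ G, ∀ p ∈ S, lo S ≤ ψ p := fun S hS p hp =>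
    csInf_le ((hM.cpt S hS).image ψc).bddBelow (mem_image_of_mem _ hp)
  have le_hi : ∀ S ∈ G, ∀ p ∈ S, ψ p ≤ hi S := fun S hS p hp =>
    le_csSup ((hM.cpt S hS).image ψc).bddAbove (mem_image_of_mem _ hp)
  have lo_mem : ∀ S ∈ G, ∃ p ∈ S, ψ p = lo S := fun S hS =>
    ((hM.cpt S hS).image ψc).sInf_mem ((hM.ne S hS).image ψ)
  have hi_mem : ∀ S ∈ G, ∃ p ∈ S, ψ p = hi S := fun S hS =>
    ((hM.cpt S hS).image ψc).sSup_mem ((hM.ne S hS).image ψ)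
  have lohi : ∀ S ∈ G, lo S ≤ hi S := by
    intro S hS
    obtain ⟨p, hp⟩ := hM.ne S hS
    exact (lo_le S hS p hp).trans (le_hi S hS p hp)
  set MU := G.filter (fun S => (∀ p ∈ S, ε ≤ p 1 - s) ∧ A' < lo S ∧ hi S < B') with hMU
  set MD := G.filter (fun S => (∀ p ∈ S, ε ≤ s - p 1) ∧ A' < lo S ∧ hi S < B') with hMD
  obtain ⟨lU, tU, u1, u2, u3, u4⟩ := greedy lo hi MU.card MU le_rfl
    (fun S hS => lohi S (Finset.mem_filter.1 hS).1)
  obtain ⟨lD, tD, d1, d2, d3, d4⟩ := greedy lo hi MD.card MD le_rfl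
    (fun S hS => lohi S (Finset.mem_filter.1 hS).1)
  by_cases hcount : k - 4 ≤ lU.length + lD.length
  · exfalso
    apply hfree
    obtain ⟨a, b, ha, hb, hab⟩ : ∃ a b, a ≤ lU.length ∧ b ≤ lD.length ∧ a + b = k - 4 :=
      ⟨min (k - 4) lU.length, k - 4 - min (k - 4) lU.length, by omega, by omega, by omega⟩
    have lenU : (lU.take a).length = a := by simp [ha]
    have lenD : (lD.take b).length = b := by simp [hb]
    have memU : ∀ T ∈ lU.take a, T ∈ G ∧ (∀ p ∈ T, ε ≤ p 1 - s) ∧ A' < lo T ∧ hi T < B' :=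
      fun T hT => Finset.mem_filter.1 (u2 T (List.mem_of_mem_take hT))
    have memD : ∀ T ∈ lD.take b, T ∈ G ∧ (∀ p ∈ T, ε ≤ s - p 1) ∧ A' < lo T ∧ hi T < B' :=
      fun T hT => Finset.mem_filter.1 (d2 T (List.mem_of_mem_take hT))
    have rel : ∀ S T : Set Plane, S ∈ G → T ∈ G → hi S < lo T → Rr u S T := by
      intro S T hS hT h p hp q hq
      exact lt_of_le_of_lt (le_hi S hS p hp) (lt_of_lt_of_le h (lo_le T hT q hq))
    have lowA : ∀ X T : Set Plane, (∀ p ∈ X, ψ p ≤ A') → T ∈ G → A' < lo T → Rr u X T := by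
      intro X T hX hT h p hp q hq
      exact lt_of_le_of_lt (hX p hp) (lt_of_lt_of_le h (lo_le T hT q hq))
    have highB : ∀ X T : Set Plane, (∀ p ∈ X, B' ≤ ψ p) → T ∈ G → hi T < B' → Rr u T X := by
      intro X T hX hT h p hp q hq
      exact lt_of_lt_of_le (lt_of_le_of_lt (le_hi T hT p hp) h) (hX q hq)
    have both : ∀ X Y : Set Plane, (∀ p ∈ X, ψ p ≤ A') → (∀ p ∈ Y, B' ≤ ψ p) → Rr u X Y := by
      intro X Y hX hY p hp q hq
      exact lt_of_le_of_lt (hX p hp) (lt_of_lt_of_le (by linarith) (hY q hq))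
    have cS0 : ∀ p ∈ S0, ψ p ≤ A' := fun p hp => by
      have := (hS0 p hp).2; simp only [hψ, hA']; linarith
    have cT0 : ∀ p ∈ T0, ψ p ≤ A' := fun p hp => by
      have := (hT0 p hp).2; simp only [hψ, hA']; linarith
    have cS1 : ∀ p ∈ S1, B' ≤ ψ p := fun p hp => by
      have := (hS1 p hp).2; simp only [hψ, hB']; linarith
    have cT1 : ∀ p ∈ T1, B' ≤ ψ p := fun p hp => by
      have := (hT1 p hp).2; simp only [hψ, hB']; linarith
    obtain ⟨f, f0, f1, fm, fr⟩ := chain u (lU.take a) S0 S1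
      ((u3.sublist (List.take_sublist _ _)).imp_of_mem
        (fun hS hT h => rel _ _ (memU _ hS).1 (memU _ hT).1 h))
      (fun T hT => lowA S0 T cS0 (memU T hT).1 (memU T hT).2.2.1)
      (fun T hT => highB S1 T cS1 (memU T hT).1 (memU T hT).2.2.2) (both _ _ cS0 cS1)
    obtain ⟨g, g0, g1, gm, gr⟩ := chain u (lD.take b) T0 T1
      ((d3.sublist (List.take_sublist _ _)).imp_of_mem
        (fun hS hT h => rel _ _ (memD _ hS).1 (memD _ hT).1 h))
      (fun T hT => lowA T0 T cT0 (memD T hT).1 (memD T hT).2.2.1)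
      (fun T hT => highB T1 T cT1 (memD T hT).1 (memD T hT).2.2.2) (both _ _ cT0 cT1)
    rw [lenU] at f1 fm fr
    rw [lenD] at g1 gm gr
    have fall : ∀ i < a + 2, f i ∈ G ∧ ∀ p ∈ f i, s < p 1 := by
      intro i hi
      by_cases c0 : i = 0
      · rw [c0, f0]; exact ⟨mS0, fun p hp => (hS0 p hp).1⟩
      by_cases c1 : i = a + 1
      · rw [c1, f1]; exact ⟨mS1, fun p hp => (hS1 p hp).1⟩
      have := memU _ (fm i (by omega) (by omega))
      exact ⟨this.1, fun p hp => by linarith [this.2.1 p hp]⟩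
    have gall : ∀ i < b + 2, g i ∈ G ∧ ∀ p ∈ g i, p 1 < s := by
      intro i hi
      by_cases c0 : i = 0
      · rw [c0, g0]; exact ⟨mT0, fun p hp => (hT0 p hp).1⟩
      by_cases c1 : i = b + 1
      · rw [c1, g1]; exact ⟨mT1, fun p hp => (hT1 p hp).1⟩
      have := memD _ (gm i (by omega) (by omega))
      exact ⟨this.1, fun p hp => by linarith [this.2.1 p hp]⟩
    refine ⟨_, ?_, cyc k (a + 2) (b + 2) (by omega) (by omega) (by omega) f g u
      (fun i hi => hM.ne _ (fall i hi).1) (fun i hi => hM.ne _ (gall i hi).1) fr gr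
      ?_ ?_ ?_ ?_ ?_⟩
    · intro i
      have := i.2
      split_ifs with h
      · exact (fall _ h).1
      · exact (gall _ (by omega)).1
    · intro j hj hj'
      rw [g0]
      by_cases c1 : j = a + 1
      · rw [c1, f1]; exact both _ _ cT0 cS1
      · have := memU _ (fm j (by omega) (by omega))
        exact lowA _ _ cT0 this.1 this.2.2.1
    · intro j hj hj'
      rw [f0]
      by_cases c1 : j = b + 1
      · rw [c1, g1]; exact both _ _ cS0 cT1
      · have := memD _ (gm j (by omega) (by omega))
        exact lowA _ _ cS0 this.1 this.2.2.1
    · intro j hj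
      rw [show b + 2 - 1 = b + 1 by omega, g1]
      by_cases c1 : j = 0
      · rw [c1, f0]; exact both _ _ cS0 cT1
      · have := memU _ (fm j (by omega) (by omega))
        exact highB _ _ cT1 this.1 this.2.2.2
    · intro j hj
      rw [show a + 2 - 1 = a + 1 by omega, f1]
      by_cases c1 : j = 0
      · rw [c1, g0]; exact both _ _ cT0 cS1
      · have := memD _ (gm j (by omega) (by omega))
        exact highB _ _ cS1 this.1 this.2.2.2
    · intro i hi j hj p hp q hq
      exact ((gall j hj).2 p hp).trans ((fall i hi).2 q hq)
  · push Not at hcount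
    refine ⟨(0, 1, s) :: (A' :: B' :: (tU ++ tD)).map (fun t => ((1:ℝ), -u, t)), ?_, ?_, ?_⟩
    · simp only [List.length_cons, List.length_map, List.length_append]
      omega
    · intro v hv
      rcases List.mem_cons.1 hv with rfl | hv
      · exact nh
      · obtain ⟨t, _, rfl⟩ := List.mem_map.1 hv
        exact nv t
    · intro S hS
      by_cases hc : (∀ p ∈ S, ε ≤ p 1 - s) ∨ (∀ p ∈ S, ε ≤ s - p 1)
      · have : ∃ t ∈ A' :: B' :: (tU ++ tD), lo S ≤ t ∧ t ≤ hi S := by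
          obtain ⟨⟨p, hp, hp'⟩, ⟨q, hq, hq'⟩⟩ := hmid' S hS hc
          have e1 : A' ≤ hi S := le_trans hp' (le_hi S hS p hp)
          have e2 : lo S ≤ B' := le_trans (lo_le S hS q hq) hq'
          by_cases c1 : A' < lo S
          · by_cases c2 : hi S < B'
            · rcases hc with hc | hc
              · obtain ⟨t, ht, h⟩ := u4 S (Finset.mem_filter.2 ⟨hS, hc, c1, c2⟩)
                exact ⟨t, by simp [ht], h⟩
              · obtain ⟨t, ht, h⟩ := d4 S (Finset.mem_filter.2 ⟨hS, hc, c1, c2⟩)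
                exact ⟨t, by simp [ht], h⟩
            · exact ⟨B', by simp, e2, not_lt.1 c2⟩
          · exact ⟨A', by simp, not_lt.1 c1, e1⟩
        obtain ⟨t, ht, h1, h2⟩ := this
        refine ⟨(1, -u, t), List.mem_cons_of_mem _ (List.mem_map.2 ⟨t, ht, rfl⟩), ?_⟩
        obtain ⟨p, hp, hp'⟩ := lo_mem S hS
        obtain ⟨q, hq, hq'⟩ := hi_mem S hS
        exact hit S hS t ⟨p, hp, by simp only [hψ] at hp'; linarith⟩
          ⟨q, hq, by simp only [hψ] at hq'; linarith⟩
      · push Not at hc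
        exact ⟨(0, 1, s), by simp, near S hS (by push Not; exact hc.1) (by push Not; exact hc.2)⟩

/-! ### Part 5: compactness -/

/-- defining form of a (possibly degenerate) line -/
def ev (w : ℝ × ℝ × ℝ) (p : Plane) : ℝ := |w.1 * p 0 + w.2.1 * p 1 - w.2.2|

def dd (S : Set Plane) (w : ℝ × ℝ × ℝ) : ℝ := sInf ((fun p => ev w p) '' S)

lemma dd_cont {S : Set Plane} (hS : IsCompact S) : Continuous (dd S) := by
  unfold dd
  apply hS.continuous_sInf (f := fun w p => ev w p)
  unfold ev Function.HasUncurry.uncurry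
  simp only [Function.hasUncurryInduction]
  fun_prop

lemma ev_cont (w : ℝ × ℝ × ℝ) : Continuous (fun p : Plane => ev w p) := by
  unfold ev; fun_prop

lemma dd_mem {S : Set Plane} (hS : IsCompact S) (hne : S.Nonempty) (w : ℝ × ℝ × ℝ) :
    ∃ p ∈ S, ev w p = dd S w :=
  (hS.image (ev_cont w)).sInf_mem (hne.image _)

lemma dd_le {S : Set Plane} (hS : IsCompact S) (w : ℝ × ℝ × ℝ) {p : Plane} (hp : p ∈ S) :
    dd S w ≤ ev w p :=
  csInf_le (hS.image (ev_cont w)).bddBelow (mem_image_of_mem _ hp)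

lemma finlem2 (k : ℕ) [NeZero k] (hk : 4 ≤ k) (G : Finset (Set Plane))
    (hF : ∀ S ∈ G, S.Nonempty ∧ IsCompact S ∧ Convex ℝ S)
    (hfree : ¬ ∃ Q : Fin k → Set Plane, (∀ i, Q i ∈ G) ∧ IsCk k Q) {ε : ℝ} (hε : 0 < ε) :
    ∃ v : Fin (k - 2) → ℝ × ℝ × ℝ, (∀ i, v i ∈ Metric.sphere (0 : ℝ × ℝ × ℝ) 1) ∧
      ∀ S ∈ G, ∃ i, dd S (v i) ≤ ε := by
  have key : ∃ l : List (ℝ × ℝ × ℝ), l.length ≤ k - 2 ∧ (∀ v ∈ l, 1 ≤ ‖v‖) ∧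
      ∀ S ∈ G, ∃ v ∈ l, ∃ p ∈ S, |v.1 * p 0 + v.2.1 * p 1 - v.2.2| ≤ ε := by
    rcases G.eq_empty_or_nonempty with rfl | hG
    · exact ⟨[], by simp, by simp, by simp⟩
    have hc : IsCompact (⋃ S ∈ G, S) := G.isCompact_biUnion (fun S hS => (hF S hS).2.1)
    obtain ⟨M0, h0⟩ := hc.exists_bound_of_continuousOn cont0.continuousOn
    obtain ⟨M1, h1⟩ := hc.exists_bound_of_continuousOn cont1.continuousOn
    have hM : Good G (max 1 (max M0 M1)) := by
      refine ⟨fun S hS => (hF S hS).1, fun S hS => (hF S hS).2.1, fun S hS => (hF S hS).2.2, ?_, ?_⟩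
      · intro S hS p hp
        exact (h0 p (mem_biUnion hS hp)).trans ((le_max_left _ _).trans (le_max_right _ _))
      · intro S hS p hp
        exact (h1 p (mem_biUnion hS hp)).trans ((le_max_right _ _).trans (le_max_right _ _))
    exact finlem k hk hG hM (lt_of_lt_of_le one_pos (le_max_left _ _)) hfree hε
  obtain ⟨l, hl, hn, hS⟩ := key
  refine ⟨fun i => if h : i.val < l.length then ‖l[i.val]‖⁻¹ • l[i.val] else (1, 0, 0), ?_, ?_⟩
  · intro i
    rw [mem_sphere_zero_iff_norm]
    beta_reduce
    split_ifs with h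
    · have := hn _ (List.getElem_mem h)
      rw [norm_smul, norm_inv, norm_norm, inv_mul_cancel₀ (by linarith)]
    · simp [Prod.norm_def]
  · intro S hSG
    obtain ⟨v, hv, p, hp, hle⟩ := hS S hSG
    obtain ⟨j, hj, rfl⟩ := List.mem_iff_getElem.1 hv
    refine ⟨⟨j, by omega⟩, ?_⟩
    refine (dd_le (hF S hSG).2.1 _ hp).trans ?_
    simp only [hj, dite_true]
    unfold ev
    have hN := hn _ hv
    set w := l[j]
    have e : (‖w‖⁻¹ • w).1 * p 0 + (‖w‖⁻¹ • w).2.1 * p 1 - (‖w‖⁻¹ • w).2.2 =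
        ‖w‖⁻¹ * (w.1 * p 0 + w.2.1 * p 1 - w.2.2) := by
      simp only [Prod.smul_fst, Prod.smul_snd, smul_eq_mul]; ring
    rw [e, abs_mul, abs_of_nonneg (by positivity)]
    calc ‖w‖⁻¹ * |w.1 * p 0 + w.2.1 * p 1 - w.2.2|
        ≤ 1 * |w.1 * p 0 + w.2.1 * p 1 - w.2.2| :=
          mul_le_mul_of_nonneg_right (inv_le_one_of_one_le₀ hN) (abs_nonneg _)
      _ ≤ ε := by linarith

lemma line_of (w : ℝ × ℝ × ℝ) (hw : w ∈ Metric.sphere (0 : ℝ × ℝ × ℝ) 1) :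
    ∃ L : Set Plane, IsLine L ∧ ∀ p : Plane, ev w p = 0 → p ∈ L := by
  obtain ⟨a, b, c⟩ := w
  by_cases h : a = 0 ∧ b = 0
  · refine ⟨_, ⟨0, !₂[1, 0], ?_, rfl⟩, ?_⟩
    · intro h0
      have := congrArg (fun q : Plane => q 0) h0
      simp at this
    · intro p hp
      exfalso
      obtain ⟨rfl, rfl⟩ := h
      simp only [ev, zero_mul, zero_add, zero_sub, abs_neg, abs_eq_zero] at hp
      subst hp
      rw [mem_sphere_zero_iff_norm] at hw
      simp at hw
  · have hpos : 0 < a ^ 2 + b ^ 2 := by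
      by_contra hc
      apply h
      constructor <;> nlinarith [sq_nonneg a, sq_nonneg b]
    refine ⟨_, ⟨!₂[a * c / (a ^ 2 + b ^ 2), b * c / (a ^ 2 + b ^ 2)], !₂[-b, a], ?_, rfl⟩, ?_⟩
    · intro h0
      have h1 := congrArg (fun q : Plane => q 0) h0
      have h2 := congrArg (fun q : Plane => q 1) h0
      simp at h1 h2
      exact h ⟨h2, h1⟩
    · intro p hp
      simp only [ev, abs_eq_zero] at hp
      have hc : c = a * p 0 + b * p 1 := by linarith
      refine ⟨(a * p 1 - b * p 0) / (a ^ 2 + b ^ 2), ?_⟩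
      ext i
      fin_cases i
      · simp
        rw [hc]
        field_simp
        ring
      · simp
        rw [hc]
        field_simp
        ring

/-- main theorem, upper bound: every C(k)-free family of nonempty
compact convex sets in the plane (k ≥ 4) can be pierced by k − 2 lines. -/
theorem ck_free_pierced_by_k_sub_two (k : ℕ) [NeZero k] (hk : 4 ≤ k)
    (F : Set (Set Plane))
    (hF : ∀ S ∈ F, S.Nonempty ∧ IsCompact S ∧ Convex ℝ S)
    (hfree : ¬ ∃ G : Fin k → Set Plane, (∀ i, G i ∈ F) ∧ IsCk k G) :
    ∃ L : Fin (k - 2) → Set Plane, (∀ i, IsLine (L i)) ∧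
      ∀ S ∈ F, ∃ i, (S ∩ L i).Nonempty := by
  have hpt : ∃ v : Fin (k - 2) → ℝ × ℝ × ℝ, (∀ i, v i ∈ Metric.sphere (0 : ℝ × ℝ × ℝ) 1) ∧
      ∀ S ∈ F, ∀ ε : ℝ, 0 < ε → ∃ i, dd S (v i) ≤ ε := by
    have hK : IsCompact (Set.pi univ
        (fun _ : Fin (k - 2) => Metric.sphere (0 : ℝ × ℝ × ℝ) 1)) :=
      isCompact_univ_pi (fun _ => isCompact_sphere _ _)
    obtain ⟨v, hv1, hv2⟩ := hK.inter_iInter_nonempty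
      (fun q : {S // S ∈ F} × {ε : ℝ // 0 < ε} =>
        ⋃ i, {v : Fin (k - 2) → ℝ × ℝ × ℝ | dd q.1.1 (v i) ≤ q.2.1})
      (by
        rintro ⟨⟨S, hS⟩, ⟨ε, hε⟩⟩
        apply isClosed_iUnion_of_finite
        intro i
        exact isClosed_le ((dd_cont (hF S hS).2.1).comp (continuous_apply i)) continuous_const)
      (by
        classical
        intro t
        obtain ⟨ε, hε, hmin⟩ : ∃ ε : ℝ, 0 < ε ∧ ∀ q ∈ t, ε ≤ q.2.1 := by
          rcases t.eq_empty_or_nonempty with rfl | ht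
          · exact ⟨1, one_pos, by simp⟩
          · obtain ⟨q, hq, h⟩ := t.exists_min_image (fun q => q.2.1) ht
            exact ⟨q.2.1, q.2.2, h⟩
        obtain ⟨v, h1, h2⟩ := finlem2 k hk (t.image (fun q => q.1.1))
          (by
            intro S hS
            obtain ⟨q, _, rfl⟩ := Finset.mem_image.1 hS
            exact hF _ q.1.2)
          (by
            rintro ⟨Q, hQ, hC⟩
            refine hfree ⟨Q, fun i => ?_, hC⟩
            obtain ⟨q, _, hq⟩ := Finset.mem_image.1 (hQ i)
            rw [← hq]
            exact q.1.2) hε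
        refine ⟨v, fun i _ => h1 i, ?_⟩
        rw [mem_iInter₂]
        intro q hq
        obtain ⟨i, hi⟩ := h2 q.1.1 (Finset.mem_image_of_mem _ hq)
        exact mem_iUnion.2 ⟨i, hi.trans (hmin q hq)⟩)
    refine ⟨v, fun i => hv1 i (mem_univ i), ?_⟩
    intro S hS ε hε
    have h := mem_iInter.1 hv2 (⟨S, hS⟩, ⟨ε, hε⟩)
    obtain ⟨i, hi⟩ := mem_iUnion.1 h
    exact ⟨i, hi⟩
  obtain ⟨v, hv1, hv2⟩ := hpt
  choose L hL1 hL2 using fun i => line_of (v i) (hv1 i)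
  refine ⟨L, hL1, ?_⟩
  intro S hS
  obtain ⟨hne, hcpt, -⟩ := hF S hS
  have : Nonempty (Fin (k - 2)) := ⟨⟨0, by omega⟩⟩
  obtain ⟨i, hi⟩ := Finite.exists_min (fun i => dd S (v i))
  obtain ⟨p, hp, hpd⟩ := dd_mem hcpt hne (v i)
  have hz : dd S (v i) ≤ 0 := by
    apply le_of_forall_pos_le_add
    intro ε hε
    obtain ⟨j, hj⟩ := hv2 S hS ε hε
    linarith [hi j]
  refine ⟨i, p, hp, hL2 i p ?_⟩
  have h0 : 0 ≤ ev (v i) p := abs_nonneg _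
  linarith
end
end
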